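/- arXiv:2011.10816 — 4 statements merged into one kernel-verified Lean document; each statement's English description precedes it below -/
import Mathlib

section
/- Under the Geometry hypothesis, every function h that is harmonic on 𝒢 and square-integrable together with its gradient on 𝒢 satisfies ‖h‖_{L²(ℱ_Σ)} ≤ √(R_+²/(R_i² − R_+²)) · ‖h‖_{L²(ℱ)}, and moreover its gradient satisfies ∫_{ℱ_Σ} |∇h|² dx ≤ (R_+²/(R_i² − R_+²)) · ∫_ℱ |∇h|² dx. (Estimate (3.12) of Lemma 3.4 and its gradient version used in the proof of Lemma 3.6.) -/
open MeasureTheory Metric Filter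

noncomputable section

abbrev Pt := EuclideanSpace ℝ (Fin 2)

/-- The Laplacian of `f : ℝ² → ℝ` at `x`, as the sum of the pure second derivatives. -/
def lap (f : Pt → ℝ) (x : Pt) : ℝ :=
  ∑ i : Fin 2, iteratedFDeriv ℝ 2 f x (fun _ => EuclideanSpace.single i (1 : ℝ))

/-- A function is harmonic on an open set `U ⊆ ℝ²` if it is `C²` on `U` and its Laplacian
vanishes on `U`. -/
def IsHarmonicOn (f : Pt → ℝ) (U : Set Pt) : Prop :=
  ContDiffOn ℝ 2 f U ∧ ∀ x ∈ U, lap f x = 0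

/-- Hypothesis 3.1 of the paper (the "Geometry" hypothesis).  The smoothness of the
boundaries plays no role in the estimates and is not recorded. -/
structure Geometry (𝒢 𝒪 : Set Pt) (c : Pt) (Re Ri Rp Rm δ δ₀ : ℝ) : Prop where
  openG : IsOpen 𝒢
  openO : IsOpen 𝒪
  bddG : Bornology.IsBounded 𝒢
  bddO : Bornology.IsBounded 𝒪
  scG : SimplyConnectedSpace 𝒢
  scO : SimplyConnectedSpace 𝒪
  clO_sub_G : closure 𝒪 ⊆ 𝒢
  Rm_pos : 0 < Rm
  Rm_lt_Rp : Rm < Rp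
  Rp_lt_Ri : Rp < Ri
  Ri_lt_Re : Ri < Re
  clG_sub : closure 𝒢 ⊆ ball c Re
  clDi_sub : closedBall c Ri ⊆ 𝒢
  clDp_sub : closedBall c Rp ⊆ ball c Ri
  clDm_sub : closedBall c Rm ⊆ ball c Rp
  clO_sub : closure 𝒪 ⊆ ball c Rm
  Rm_eq : Rm = Re * Real.exp (-δ ^ 2)
  Rp_eq : Rp = Re * Real.exp (-δ)
  δ₀_eq : δ₀ = 2 + Real.log (Re / Ri)
  δ₀_lt_δ : δ₀ < δ

theorem key_holo {f : ℂ → ℂ} {R R' l : ℝ} (hR : 0 < R) (hRR : R < R') (hl0 : 0 < l) (hl1 : l < 1)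
    (hf : AnalyticOnNhd ℂ f (ball 0 R')) :
    ∫ y in ball (0:ℂ) R, (f (l * y)).re ^ 2 ≤ ∫ y in ball (0:ℂ) R, (f y).re ^ 2 := by
  obtain ⟨S, hRS, hSR⟩ := exists_between hRR
  have hS : 0 < S := hR.trans hRS
  have hsub : closedBall (0:ℂ) S ⊆ ball 0 R' := closedBall_subset_ball hSR
  have hfc : ContinuousOn f (closedBall 0 S) := hf.continuousOn.mono hsub
  have hdc : ContinuousOn (deriv f) (closedBall 0 S) := (hf.deriv).continuousOn.mono hsub
  obtain ⟨M, hM⟩ := (isCompact_closedBall (0:ℂ) S).exists_bound_of_continuousOn hfc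
  obtain ⟨N, hN⟩ := (isCompact_closedBall (0:ℂ) S).exists_bound_of_continuousOn hdc
  have hM0 : 0 ≤ M := (norm_nonneg _).trans (hM 0 (by simp [hS.le]))
  have hN0 : 0 ≤ N := (norm_nonneg _).trans (hN 0 (by simp [hS.le]))
  have hmaps : ∀ w ∈ ball (0:ℂ) (S/R), ∀ y ∈ ball (0:ℂ) R, w * y ∈ closedBall (0:ℂ) S := by
    intro w hw y hy
    simp only [mem_ball, dist_zero_right, mem_closedBall, norm_mul] at *
    calc ‖w‖ * ‖y‖ ≤ (S/R) * R := by gcongr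
      _ = S := by field_simp
  have hSR1 : 1 < S / R := by rw [lt_div_iff₀ hR]; linarith
  have hlmem : (l:ℂ) ∈ ball (0:ℂ) (S/R) := by
    simp [abs_of_pos hl0]; linarith
  have h1mem : (1:ℂ) ∈ ball (0:ℂ) (S/R) := by simpa using hSR1
  have hcw : ∀ w ∈ ball (0:ℂ) (S/R), ContinuousOn (fun y => f (w * y)) (ball 0 R) := by
    intro w hw
    exact hfc.comp (by fun_prop) (fun y hy => hmaps w hw y hy)
  have hdw : ∀ w ∈ ball (0:ℂ) (S/R), ContinuousOn (fun y => deriv f (w * y)) (ball 0 R) := by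
    intro w hw
    exact hdc.comp (by fun_prop) (fun y hy => hmaps w hw y hy)
  have hint : ∀ {E : Type} [NormedAddCommGroup E] (g : ℂ → E) (C : ℝ), ContinuousOn g (ball 0 R) →
      (∀ y ∈ ball (0:ℂ) R, ‖g y‖ ≤ C) → IntegrableOn g (ball 0 R) := by
    intro E _ g C hg hb
    have : IsFiniteMeasure ((volume : Measure ℂ).restrict (ball 0 R)) :=
      isFiniteMeasure_restrict.2 measure_ball_lt_top.ne
    refine Integrable.of_bound (hg.aestronglyMeasurable measurableSet_ball) C ?_
    exact (ae_restrict_iff' measurableSet_ball).2 (.of_forall hb)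
  have hre : ∀ w ∈ ball (0:ℂ) (S/R), ContinuousOn (fun y => (f (w * y)).re) (ball 0 R) :=
    fun w hw => Complex.continuous_re.comp_continuousOn (hcw w hw)
  have hreb : ∀ w ∈ ball (0:ℂ) (S/R), ∀ y ∈ ball (0:ℂ) R, |(f (w * y)).re| ≤ M :=
    fun w hw y hy => (Complex.abs_re_le_norm _).trans (hM _ (hmaps w hw y hy))
  have hintRe : ∀ w ∈ ball (0:ℂ) (S/R), ∀ w' ∈ ball (0:ℂ) (S/R),
      IntegrableOn (fun y => (f (w * y)).re * (f (w' * y)).re) (ball 0 R) := by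
    intro w hw w' hw'
    refine hint _ (M * M) ((hre w hw).mul (hre w' hw')) ?_
    intro y hy
    rw [norm_mul]
    exact mul_le_mul (hreb w hw y hy) (hreb w' hw' y hy) (norm_nonneg _) hM0
  set u : ℂ → ℝ := fun y => (f (l * y)).re with hu
  set G : ℂ → ℂ := fun w => ∫ y in ball (0:ℂ) R, f (w * y) * (u y : ℂ) with hG
  have huc : ContinuousOn (fun y => (u y : ℂ)) (ball 0 R) :=
    Complex.continuous_ofReal.comp_continuousOn (hre l hlmem)
  have hub : ∀ y ∈ ball (0:ℂ) R, ‖(u y : ℂ)‖ ≤ M := by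
    intro y hy; simpa using hreb l hlmem y hy
  have hintG : ∀ w ∈ ball (0:ℂ) (S/R),
      IntegrableOn (fun y => f (w * y) * (u y : ℂ)) (ball 0 R) := by
    intro w hw
    refine hint _ (M * M) ((hcw w hw).mul huc) ?_
    intro y hy
    rw [norm_mul]
    exact mul_le_mul (hM _ (hmaps w hw y hy)) (hub y hy) (norm_nonneg _) hM0
  have hGd : DifferentiableOn ℂ G (ball 0 (S/R)) := by
    intro w hw
    have := hasDerivAt_integral_of_dominated_loc_of_deriv_le (𝕜 := ℂ)
      (μ := (volume : Measure ℂ).restrict (ball 0 R))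
      (F := fun w y => f (w * y) * (u y : ℂ)) (F' := fun w y => deriv f (w * y) * y * (u y : ℂ))
      (bound := fun _ => N * R * M) (x₀ := w) (isOpen_ball.mem_nhds hw)
      (by
        filter_upwards [isOpen_ball.mem_nhds hw] with w' hw'
        exact (hintG w' hw').aestronglyMeasurable)
      (hintG w hw)
      ((((hdw w hw).mul continuousOn_id).mul huc).aestronglyMeasurable measurableSet_ball)
      ((ae_restrict_iff' measurableSet_ball).2 (.of_forall fun y hy w' hw' => by
        rw [norm_mul, norm_mul]
        have h1 := hN _ (hmaps w' hw' y hy)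
        have h2 : ‖y‖ ≤ R := by simpa using (mem_ball_zero_iff.1 hy).le
        have h3 := hub y hy
        gcongr))
      (hint (fun _ => N * R * M) (‖N*R*M‖) continuousOn_const (fun _ _ => le_rfl))
      ((ae_restrict_iff' measurableSet_ball).2 (.of_forall fun y hy w' hw' => by
        have h1 : HasDerivAt f (deriv f (w' * y)) (w' * y) :=
          (hf _ (hsub (hmaps w' hw' y hy))).differentiableAt.hasDerivAt
        have h2 : HasDerivAt (fun w : ℂ => w * y) y w' := by
          simpa using (hasDerivAt_id w').mul_const y
        exact (h1.comp w' h2).mul_const _))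
    exact this.2.differentiableAt.differentiableWithinAt
  have hGre : ∀ w ∈ ball (0:ℂ) (S/R), (G w).re = ∫ y in ball (0:ℂ) R, (f (w * y)).re * u y := by
    intro w hw
    have := (Complex.reCLM.integral_comp_comm (hintG w hw))
    simp only [hG]
    rw [← Complex.reCLM_apply, ← this]
    simp
  set A := ∫ y in ball (0:ℂ) R, (f (l * y)).re ^ 2 with hA
  set B := ∫ y in ball (0:ℂ) R, (f y).re ^ 2 with hB
  have hrot : ∀ w : ℂ, ‖w‖ = 1 → ∫ y in ball (0:ℂ) R, (f (w * y)).re * (f (w * y)).re = B := by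
    intro w hw
    let ρ : ℂ ≃ₗᵢ[ℝ] ℂ := rotation ⟨w, by simpa [Submonoid.unitSphere] using hw⟩
    have hmp := ρ.measurePreserving
    have := hmp.setIntegral_preimage_emb ρ.toHomeomorph.measurableEmbedding
      (fun y => (f y).re ^ 2) (ball 0 R)
    have hpre : ρ ⁻¹' (ball 0 R) = ball 0 R := by
      ext y; simp
    rw [hpre] at this
    rw [hB, ← this]
    refine integral_congr_ae (.of_forall fun y => ?_)
    have hy : ρ y = w * y := rotation_apply _ _
    simp only [hy, sq]
  have hball1 : closedBall (0:ℂ) 1 ⊆ ball 0 (S/R) := closedBall_subset_ball hSR1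
  have hbd : ∀ w : ℂ, ‖w‖ = 1 → (G w).re ≤ (A + B) / 2 := by
    intro w hw
    have hw' : w ∈ ball (0:ℂ) (S/R) := hball1 (by simp [hw])
    rw [hGre w hw']
    have : (A + B) / 2 = ∫ y in ball (0:ℂ) R,
        ((1/2) * (u y * u y) + (1/2) * ((f (w * y)).re * (f (w * y)).re)) := by
      rw [integral_add ((hintRe l hlmem l hlmem).const_mul _) ((hintRe w hw' w hw').const_mul _),
        integral_const_mul, integral_const_mul, hrot w hw, hA]
      simp only [hu, sq]; ring
    rw [this]
    refine integral_mono (hintRe w hw' l hlmem) (((hintRe l hlmem l hlmem).const_mul _).add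
      ((hintRe w hw' w hw').const_mul _)) ?_
    intro y
    simp only [hu, Pi.add_apply]
    nlinarith [sq_nonneg ((f (w * y)).re - (f (l * y)).re)]
  have hdcc : DiffContOnCl ℂ (fun w => Complex.exp (G w)) (ball 0 1) := by
    have : DifferentiableOn ℂ (fun w => Complex.exp (G w)) (ball 0 (S/R)) := hGd.cexp
    refine (this.mono ?_).diffContOnCl
    rw [closure_ball _ one_ne_zero]; exact hball1
  have hmax := Complex.norm_le_of_forall_mem_frontier_norm_le isBounded_ball hdcc
    (C := Real.exp ((A+B)/2)) (by
      intro w hw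
      rw [frontier_ball _ one_ne_zero] at hw
      rw [Complex.norm_exp]
      exact Real.exp_le_exp.2 (hbd w (by simpa using hw)))
    (z := (l:ℂ)) (subset_closure (by simpa [abs_of_pos hl0] using hl1))
  rw [Complex.norm_exp, Real.exp_le_exp, hGre l hlmem] at hmax
  have : ∫ y in ball (0:ℂ) R, (f (l * y)).re * u y = A := by
    simp only [hA, hu, sq]
  linarith

def eP : ℂ ≃ₗᵢ[ℝ] Pt := Complex.orthonormalBasisOneI.repr

theorem harm_transfer {h : Pt → ℝ} {U : Set Pt} (hU : IsOpen U) (hh : IsHarmonicOn h U) (c : Pt)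
    {z : ℂ} (hz : c + eP z ∈ U) : InnerProductSpace.HarmonicAt (fun z => h (c + eP z)) z := by
  have hev : ∀ᶠ z' in nhds z, c + eP z' ∈ U := by
    have : Continuous (fun z' => c + eP z') := by fun_prop
    exact this.continuousAt.eventually (hU.mem_nhds hz)
  refine ⟨?_, ?_⟩
  · have h1 : ContDiffAt ℝ 2 h (c + eP z) := hh.1.contDiffAt (hU.mem_nhds hz)
    exact h1.comp z (contDiffAt_const.add eP.contDiff.contDiffAt)
  · filter_upwards [hev] with z' hz'
    have h2 := hh.2 _ hz'
    rw [InnerProductSpace.laplacian_eq_iteratedFDeriv_orthonormalBasis _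
      Complex.orthonormalBasisOneI]
    have : (fun z => h (c + eP z)) = (fun x => h (c + x)) ∘ eP.toContinuousLinearEquiv := rfl
    rw [this]
    simp only [← iteratedFDerivWithin_univ]
    have hpre : (Set.univ : Set ℂ) = eP.toContinuousLinearEquiv ⁻¹' Set.univ := rfl
    rw [hpre]
    simp only [ContinuousLinearEquiv.iteratedFDerivWithin_comp_right _ _ uniqueDiffOn_univ
      (Set.mem_univ _), iteratedFDerivWithin_univ, iteratedFDeriv_comp_add_left]
    rw [lap] at h2
    simp only [Pi.zero_apply]
    rw [← h2]
    refine Finset.sum_congr rfl fun i _ => ?_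
    simp only [ContinuousMultilinearMap.compContinuousLinearMap_apply]
    congr 1
    ext j k
    fin_cases i <;> fin_cases j <;> fin_cases k <;> simp [eP]

theorem final_step (𝒢 𝒪 : Set Pt) (c : Pt) (Re Ri Rp Rm δ δ₀ : ℝ)
    (geom : Geometry 𝒢 𝒪 c Re Ri Rp Rm δ δ₀) (U : Pt → ℝ) (hU0 : ∀ x, 0 ≤ U x)
    (hUi : IntegrableOn U 𝒢)
    (hU : ∫ y in ball (0:ℂ) Ri, U (c + eP ((Rp / Ri : ℝ) * y)) ≤
      ∫ y in ball (0:ℂ) Ri, U (c + eP y)) :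
    ∫ x in ball c Rp \ closure 𝒪, U x ≤
      Rp ^ 2 / (Ri ^ 2 - Rp ^ 2) * ∫ x in 𝒢 \ closure 𝒪, U x := by
  have hRp : 0 < Rp := geom.Rm_pos.trans geom.Rm_lt_Rp
  have hRi : 0 < Ri := hRp.trans geom.Rp_lt_Ri
  have hpi := geom.Rp_lt_Ri
  have htr : ∀ r, ∫ y in ball (0:ℂ) r, U (c + eP y) = ∫ x in ball c r, U x := by
    intro r
    have hmp : MeasurePreserving (fun y : ℂ => c + eP y) :=
      (measurePreserving_add_left volume c).comp eP.measurePreserving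
    have hem : MeasurableEmbedding (fun y : ℂ => c + eP y) :=
      (measurableEmbedding_addLeft c).comp eP.toHomeomorph.measurableEmbedding
    have := hmp.setIntegral_preimage_emb hem U (ball c r)
    rw [← this]
    congr 2
    ext y; simp
  have hsc := Measure.setIntegral_comp_smul_of_pos (volume : Measure ℂ)
    (fun y => U (c + eP y)) (ball (0:ℂ) Ri) (div_pos hRp hRi)
  rw [_root_.smul_ball (div_pos hRp hRi).ne'] at hsc
  have e1 : ‖Rp / Ri‖ * Ri = Rp := by
    rw [Real.norm_of_nonneg (div_pos hRp hRi).le]; field_simp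
  rw [e1, smul_zero, htr Rp, Complex.finrank_real_complex, smul_eq_mul] at hsc
  simp only [Complex.real_smul] at hsc
  rw [hsc, htr Ri] at hU
  have hsubpi : ball c Rp ⊆ ball c Ri := ball_subset_ball hpi.le
  have hsubG : ball c Ri ⊆ 𝒢 := ball_subset_closedBall.trans geom.clDi_sub
  have hIi : IntegrableOn U (ball c Ri) := hUi.mono_set hsubG
  have hIp : IntegrableOn U (ball c Rp) := hIi.mono_set hsubpi
  have hd := integral_diff measurableSet_ball hIi hsubpi
  have hOp : closure 𝒪 ⊆ ball c Rp := geom.clO_sub.trans (ball_subset_ball geom.Rm_lt_Rp.le)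
  have h1 : ∫ x in ball c Rp \ closure 𝒪, U x ≤ ∫ x in ball c Rp, U x :=
    setIntegral_mono_set hIp (.of_forall hU0) (.of_forall Set.diff_subset)
  have h2 : ∫ x in ball c Ri \ ball c Rp, U x ≤ ∫ x in 𝒢 \ closure 𝒪, U x :=
    setIntegral_mono_set (hUi.mono_set Set.diff_subset) (.of_forall hU0)
      (.of_forall (Set.diff_subset_diff hsubG hOp))
  rw [hd] at h2
  have hpos : 0 < Ri ^ 2 - Rp ^ 2 := by nlinarith
  refine h1.trans ?_
  rw [div_mul_eq_mul_div, le_div_iff₀ hpos]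
  set a := ∫ x in ball c Rp, U x
  set b := ∫ x in ball c Ri, U x
  have h3 : Ri ^ 2 * a ≤ Rp ^ 2 * b := by
    have : ((Rp / Ri) ^ 2)⁻¹ * a = Ri ^ 2 * a / Rp ^ 2 := by field_simp
    rw [this, div_le_iff₀ (by positivity)] at hU
    linarith
  nlinarith [mul_le_mul_of_nonneg_left h2 (sq_nonneg Rp)]

theorem norm_sq_clm (L : ℂ →L[ℝ] ℝ) : ‖L‖ ^ 2 = L 1 ^ 2 + L Complex.I ^ 2 := by
  obtain ⟨v, rfl⟩ := (InnerProductSpace.toDual ℝ ℂ).surjective L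
  rw [LinearIsometryEquiv.norm_map]
  simp [InnerProductSpace.toDual_apply_apply, Complex.inner, Complex.sq_norm, Complex.normSq_apply]
  ring

theorem grad_transfer {h : Pt → ℝ} (c : Pt) (z : ℂ) :
    ‖gradient h (c + eP z)‖ ^ 2 = (fderiv ℝ (fun z => h (c + eP z)) z 1) ^ 2 +
      (fderiv ℝ (fun z => h (c + eP z)) z Complex.I) ^ 2 := by
  rw [← norm_sq_clm, gradient, LinearIsometryEquiv.norm_map]
  have : (fun z => h (c + eP z)) = (fun x => h (c + x)) ∘ eP.toContinuousLinearEquiv := rfl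
  rw [this, ContinuousLinearEquiv.comp_right_fderiv, fderiv_comp_add_left]
  congr 1
  exact (ContinuousLinearMap.opNorm_comp_linearIsometryEquiv _ eP).symm

theorem stmt8 (𝒢 𝒪 : Set Pt) (c : Pt) (Re Ri Rp Rm δ δ₀ : ℝ)
    (geom : Geometry 𝒢 𝒪 c Re Ri Rp Rm δ δ₀)
    (h : Pt → ℝ) (hharm : IsHarmonicOn h 𝒢)
    (hL2 : IntegrableOn (fun x => h x ^ 2) 𝒢)
    (hdir : IntegrableOn (fun x => ‖gradient h x‖ ^ 2) 𝒢) :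
    Real.sqrt (∫ x in ball c Rp \ closure 𝒪, h x ^ 2)
        ≤ Real.sqrt (Rp ^ 2 / (Ri ^ 2 - Rp ^ 2))
            * Real.sqrt (∫ x in 𝒢 \ closure 𝒪, h x ^ 2)
      ∧ (∫ x in ball c Rp \ closure 𝒪, ‖gradient h x‖ ^ 2)
        ≤ Rp ^ 2 / (Ri ^ 2 - Rp ^ 2) * ∫ x in 𝒢 \ closure 𝒪, ‖gradient h x‖ ^ 2 := by
  have hRp : 0 < Rp := geom.Rm_pos.trans geom.Rm_lt_Rp
  have hpi := geom.Rp_lt_Ri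
  have hRi : 0 < Ri := hRp.trans hpi
  have hl0 : 0 < Rp / Ri := div_pos hRp hRi
  have hl1 : Rp / Ri < 1 := (div_lt_one hRi).2 hpi
  have hpos : 0 < Ri ^ 2 - Rp ^ 2 := by nlinarith
  obtain ⟨ε, hε, hsub⟩ :=
    (isCompact_closedBall c Ri).exists_thickening_subset_open geom.openG geom.clDi_sub
  rw [thickening_closedBall hε hRi.le] at hsub
  have hH : InnerProductSpace.HarmonicOnNhd (fun z => h (c + eP z)) (ball 0 (ε + Ri)) := by
    intro z hz
    refine harm_transfer geom.openG hharm c (hsub ?_)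
    simpa using hz
  have hlt : Ri < ε + Ri := by linarith
  have hmem : ∀ y ∈ ball (0:ℂ) Ri, y ∈ ball (0:ℂ) (ε + Ri) := fun y hy =>
    ball_subset_ball hlt.le hy
  have hmeml : ∀ y ∈ ball (0:ℂ) Ri, ((Rp / Ri : ℝ) : ℂ) * y ∈ ball (0:ℂ) Ri := by
    intro y hy
    rw [mem_ball_zero_iff] at *
    rw [norm_mul, Complex.norm_real, Real.norm_of_nonneg hl0.le]
    nlinarith [norm_nonneg y]
  constructor
  · rw [← Real.sqrt_mul (by positivity)]
    refine Real.sqrt_le_sqrt (final_step 𝒢 𝒪 c Re Ri Rp Rm δ δ₀ geom _ (fun _ => sq_nonneg _) hL2 ?_)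
    obtain ⟨F, hF, hFe⟩ := hH.exists_analyticOnNhd_ball_re_eq
    have hk := key_holo hRi hlt hl0 hl1 hF
    convert hk using 1
    · refine setIntegral_congr_fun measurableSet_ball fun y hy => ?_
      have := hFe (hmem _ (hmeml y hy))
      simp only at this ⊢
      rw [this]
    · refine setIntegral_congr_fun measurableSet_ball fun y hy => ?_
      have := hFe (hmem _ hy)
      simp only at this ⊢
      rw [this]
  · refine final_step 𝒢 𝒪 c Re Ri Rp Rm δ δ₀ geom _ (fun _ => sq_nonneg _) hdir ?_
    set H : ℂ → ℝ := fun z => h (c + eP z) with hHdef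
    set g : ℂ → ℂ := fun z => fderiv ℝ H z 1 - Complex.I * fderiv ℝ H z Complex.I with hg
    have hga : AnalyticOnNhd ℂ g (ball 0 (ε + Ri)) := fun z hz =>
      HarmonicAt.analyticAt_complex_partial (hH z hz)
    have hga' : AnalyticOnNhd ℂ (fun z => Complex.I * g z) (ball 0 (ε + Ri)) :=
      analyticOnNhd_const.mul hga
    have hk1 := key_holo hRi hlt hl0 hl1 hga
    have hk2 := key_holo hRi hlt hl0 hl1 hga'
    have hgr : ∀ z, ‖gradient h (c + eP z)‖ ^ 2 = (g z).re ^ 2 + (Complex.I * g z).re ^ 2 := by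
      intro z
      rw [grad_transfer]
      simp [hg, hHdef]
    have hint : ∀ k : ℂ → ℂ, AnalyticOnNhd ℂ k (ball 0 (ε + Ri)) →
        IntegrableOn (fun y => (k y).re ^ 2) (ball 0 Ri) ∧
        IntegrableOn (fun y => (k ((Rp / Ri : ℝ) * y)).re ^ 2) (ball 0 Ri) := by
      intro k hk
      have hkc : ContinuousOn (fun y => (k y).re ^ 2) (closedBall 0 Ri) :=
        (Complex.continuous_re.comp_continuousOn
          (hk.continuousOn.mono (closedBall_subset_ball hlt))).pow 2
      refine ⟨(hkc.integrableOn_compact (isCompact_closedBall _ _)).mono_set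
        ball_subset_closedBall, ?_⟩
      have : ContinuousOn (fun y : ℂ => (k ((Rp / Ri : ℝ) * y)).re ^ 2) (closedBall 0 Ri) := by
        refine hkc.comp (f := fun y : ℂ => ((Rp / Ri : ℝ) : ℂ) * y) (by fun_prop) ?_
        intro y hy
        rw [mem_closedBall_zero_iff] at *
        rw [norm_mul, Complex.norm_real, Real.norm_of_nonneg hl0.le]
        nlinarith [norm_nonneg y]
      exact (this.integrableOn_compact (isCompact_closedBall _ _)).mono_set
        ball_subset_closedBall
    simp only [hgr]
    rw [integral_add (hint g hga).2 (hint _ hga').2, integral_add (hint g hga).1 (hint _ hga').1]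
    exact add_le_add hk1 hk2
end
end

section
/- Under the Geometry hypothesis, let g be harmonic on 𝒢 and square-integrable on 𝒢, and let h be harmonic on 𝒦 = ℝ² ∖ closure(𝒪), locally square-integrable on 𝒦, with h(x) → 0 as |x| → ∞. Then |∫_ℱ g(x) h(x) dx| ≤ ( √(R_+²/(R_i² − R_-²)) + √(1/δ) ) · ‖g‖_{L²(ℱ)} · ‖h‖_{L²(ℱ)}. (Almost-orthogonality estimate from the proof of Lemma 3.5.) -/
open MeasureTheory Metric Filter

noncomputable section

open Complex in
lemma contCirc {E : Type*} [TopologicalSpace E] {f : ℂ → E} {R : ℝ} (hf : ContinuousOn f (ball 0 R)) {z : ℂ} (hz : ‖z‖ < R) :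
    Continuous (fun θ : ℝ => f (z * exp (θ * I))) := by
  refine hf.comp_continuous (by fun_prop) ?_
  intro θ
  simpa [norm_exp_ofReal_mul_I] using hz

open Complex in
lemma rotInt (u : ℂ → ℝ) (z : ℂ) :
    ∫ θ in (0:ℝ)..2 * Real.pi, u (z * exp (θ * I)) = ∫ θ in (0:ℝ)..2 * Real.pi, u ((‖z‖ : ℂ) * exp (θ * I)) := by
  have hz : z = (‖z‖ : ℂ) * exp (arg z * I) := (norm_mul_exp_arg_mul_I z).symm
  have h1 : ∀ θ : ℝ, z * exp (θ * I) = (‖z‖ : ℂ) * exp (((θ + arg z : ℝ) : ℂ) * I) := by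
    intro θ
    conv_lhs => rw [hz]
    rw [mul_assoc, ← exp_add]; push_cast; ring_nf
  simp_rw [h1]
  rw [intervalIntegral.integral_comp_add_right (fun θ : ℝ => u ((‖z‖ : ℂ) * exp ((θ:ℂ) * I)))]
  have hp : Function.Periodic (fun θ : ℝ => u ((‖z‖ : ℂ) * exp ((θ:ℂ) * I))) (2 * Real.pi) := by
    intro θ
    have : exp (((θ + 2 * Real.pi : ℝ):ℂ) * I) = exp (θ * I) := by
      push_cast; rw [add_mul, exp_add, exp_two_pi_mul_I, mul_one]
    simp only [this]
  have := hp.intervalIntegral_add_eq (arg z) 0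
  simp only [zero_add] at this ⊢
  rw [← this, add_comm]

open Complex in
lemma monoHol {f : ℂ → ℂ} {R r s : ℝ} (hf : DifferentiableOn ℂ f (ball 0 R)) (h0 : 0 ≤ r) (hrs : r ≤ s)
    (hs : s < R) :
    ∫ θ in (0:ℝ)..2 * Real.pi, ‖f (r * exp (θ * I))‖ ^ 2 ≤
      ∫ θ in (0:ℝ)..2 * Real.pi, ‖f (s * exp (θ * I))‖ ^ 2 := by
  have hpi : (0:ℝ) ≤ 2 * Real.pi := by positivity
  have hc := hf.continuousOn
  have hrR : ‖(r:ℂ)‖ < R := by rw [norm_real, Real.norm_eq_abs, abs_of_nonneg h0]; linarith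
  set k : ℝ → ℂ := fun θ => (starRingEnd ℂ) (f (r * exp (θ * I))) with hk
  have hkc : Continuous k := continuous_conj.comp (contCirc hc hrR)
  set Φ : ℂ → ℂ := fun z => ∫ θ in (0:ℝ)..2 * Real.pi, f (z * exp (θ * I)) * k θ with hΦ
  have hΦd : DifferentiableOn ℂ Φ (ball 0 R) := by
    intro z hz
    rw [mem_ball_zero_iff] at hz
    set ρ := (‖z‖ + R) / 2 with hρ
    have hd := (hf.deriv isOpen_ball).continuousOn
    have hsub : closedBall (0:ℂ) ρ ⊆ ball 0 R := closedBall_subset_ball (by rw [hρ]; linarith)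
    obtain ⟨C, hC⟩ := (isCompact_closedBall (0:ℂ) ρ).exists_bound_of_continuousOn (hd.mono hsub)
    have key := intervalIntegral.hasDerivAt_integral_of_dominated_loc_of_deriv_le (μ := volume)
      (a := 0) (b := 2 * Real.pi) (s := ball (0:ℂ) ρ) (x₀ := z)
      (F := fun z θ => f (z * exp (θ * I)) * k θ)
      (F' := fun z θ => deriv f (z * exp (θ * I)) * exp (θ * I) * k θ)
      (bound := fun θ => C * ‖k θ‖)
      (isOpen_ball.mem_nhds (by rw [mem_ball_zero_iff, hρ]; linarith))
      ?_ ?_ ?_ ?_ ?_ ?_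
    · exact key.2.differentiableAt.differentiableWithinAt
    · filter_upwards [isOpen_ball.mem_nhds (mem_ball_zero_iff.2 hz)] with w hw
      rw [mem_ball_zero_iff] at hw
      exact ((contCirc hc hw).mul hkc).aestronglyMeasurable
    · exact ((contCirc hc hz).mul hkc).intervalIntegrable _ _
    · have : Continuous (fun θ : ℝ => exp (θ * I)) := by fun_prop
      exact (((contCirc hd hz).mul this).mul hkc).aestronglyMeasurable
    · refine ae_of_all _ fun θ _ w hw => ?_
      rw [norm_mul, norm_mul, norm_exp_ofReal_mul_I, mul_one]
      gcongr
      apply hC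
      rw [mem_ball_zero_iff] at hw
      simpa [norm_exp_ofReal_mul_I] using hw.le
    · exact (continuous_const.mul hkc.norm).intervalIntegrable _ _
    · refine ae_of_all _ fun θ _ w hw => ?_
      rw [mem_ball_zero_iff] at hw
      have hw' : w * exp (θ * I) ∈ ball (0:ℂ) R := by
        rw [mem_ball_zero_iff, norm_mul, norm_exp_ofReal_mul_I, mul_one]; linarith
      have h1 := (hf.differentiableAt (isOpen_ball.mem_nhds hw')).hasDerivAt
      have h2 : HasDerivAt (fun w => w * exp (θ * I)) (exp (θ * I)) w := by
        simpa using (hasDerivAt_id w).mul_const (exp (θ * I))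
      exact (h1.comp w h2).mul_const _
  set A := ∫ θ in (0:ℝ)..2 * Real.pi, ‖f (r * exp (θ * I))‖ ^ 2 with hA
  set B := ∫ θ in (0:ℝ)..2 * Real.pi, ‖f (s * exp (θ * I))‖ ^ 2 with hB
  have hΦr : Φ r = (A : ℂ) := by
    rw [hA, ← intervalIntegral.integral_ofReal]
    simp only [hΦ, hk]
    congr 1; ext θ
    rw [mul_conj, normSq_eq_norm_sq]
  have hbd : ∀ z ∈ sphere (0:ℂ) s, ‖Φ z‖ ≤ (A + B) / 2 := by
    intro z hz
    rw [mem_sphere_zero_iff_norm] at hz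
    have hzR : ‖z‖ < R := by linarith
    have c1 := contCirc hc hzR
    have c2 := contCirc hc hrR
    have e1 : B = ∫ θ in (0:ℝ)..2 * Real.pi, ‖f (z * exp (θ * I))‖ ^ 2 := by
      rw [rotInt (fun w => ‖f w‖ ^ 2) z, hz]
    calc ‖Φ z‖ ≤ ∫ θ in (0:ℝ)..2 * Real.pi, ‖f (z * exp (θ * I)) * k θ‖ :=
          intervalIntegral.norm_integral_le_integral_norm hpi
      _ ≤ ∫ θ in (0:ℝ)..2 * Real.pi, (‖f (r * exp (θ * I))‖ ^ 2 + ‖f (z * exp (θ * I))‖ ^ 2) / 2 := by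
          apply intervalIntegral.integral_mono_on hpi
          · exact (c1.mul hkc).norm.intervalIntegrable _ _
          · exact (((c2.norm.pow 2).add (c1.norm.pow 2)).div_const 2).intervalIntegrable _ _
          · intro θ _
            simp only [hk, norm_mul, RCLike.norm_conj]
            nlinarith [sq_nonneg (‖f (r * exp (θ * I))‖ - ‖f (z * exp (θ * I))‖)]
      _ = (A + B) / 2 := by
          rw [intervalIntegral.integral_div, intervalIntegral.integral_add, e1]
          · exact (c2.norm.pow 2).intervalIntegrable _ _
          · exact (c1.norm.pow 2).intervalIntegrable _ _
  have hA0 : 0 ≤ A := intervalIntegral.integral_nonneg hpi (fun _ _ => by positivity)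
  rcases hrs.eq_or_lt with rfl | hlt
  · exact le_of_eq rfl
  have hs0 : s ≠ 0 := by linarith
  have hmax := Complex.norm_le_of_forall_mem_frontier_norm_le (f := Φ) (U := ball (0:ℂ) s) (C := (A + B) / 2)
    isBounded_ball ?_ ?_ (z := (r:ℂ)) ?_
  · rw [hΦr, norm_real, Real.norm_eq_abs, abs_of_nonneg hA0] at hmax
    linarith
  · apply DifferentiableOn.diffContOnCl
    rw [closure_ball _ hs0]
    exact hΦd.mono (closedBall_subset_ball hs)
  · rw [frontier_ball _ hs0]; exact hbd
  · rw [closure_ball _ hs0]; simpa [abs_of_nonneg h0] using hrs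

noncomputable def cM (u : ℂ → ℝ) (r : ℝ) : ℝ :=
  ∫ θ in (0:ℝ)..2 * Real.pi, u (r * Complex.exp (θ * Complex.I)) ^ 2

open Complex in
lemma cM_eq {f : ℂ → ℂ} {u : ℂ → ℝ} {R r : ℝ} (hf : DifferentiableOn ℂ f (ball 0 R)) (h0 : 0 < r)
    (hr : r < R) (hu : ∀ z ∈ ball (0:ℂ) R, z ≠ 0 → u z = (f z).re) :
    cM u r = (∫ θ in (0:ℝ)..2 * Real.pi, ‖f (r * exp (θ * I))‖ ^ 2) / 2 + Real.pi * (f 0 ^ 2).re := by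
  have hn : ‖(r:ℂ)‖ = r := by rw [norm_real, Real.norm_eq_abs, abs_of_pos h0]
  have hrR : ‖(r:ℂ)‖ < R := by rw [hn]; exact hr
  have hc := contCirc hf.continuousOn hrR
  have hmv : ∫ θ in (0:ℝ)..2 * Real.pi, f (r * exp (θ * I)) ^ 2 = 2 * Real.pi * f 0 ^ 2 := by
    have := DiffContOnCl.circleAverage (f := fun z => f z ^ 2) (R := r) (c := 0) ?_
    · rw [Real.circleAverage] at this
      simp only [circleMap_zero] at this
      rw [← this, real_smul]
      have : (Real.pi : ℂ) ≠ 0 := by exact_mod_cast Real.pi_ne_zero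
      push_cast; rw [← mul_assoc, mul_inv_cancel₀ (by simpa using this), one_mul]
    · apply DifferentiableOn.diffContOnCl
      rw [abs_of_pos h0, closure_ball _ h0.ne']
      exact (hf.mono (closedBall_subset_ball hr)).pow 2
  have hre : ∫ θ in (0:ℝ)..2 * Real.pi, (f (r * exp (θ * I)) ^ 2).re = 2 * Real.pi * (f 0 ^ 2).re := by
    have h1 := reCLM.intervalIntegral_comp_comm ((hc.pow 2).intervalIntegrable (μ := volume) 0 (2 * Real.pi))
    simp only [reCLM_apply, Pi.pow_apply] at h1
    rw [h1, hmv]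
    have : (2 * (Real.pi:ℂ)) = ((2 * Real.pi : ℝ) : ℂ) := by push_cast; rfl
    rw [this, re_ofReal_mul]
  have : cM u r = ∫ θ in (0:ℝ)..2 * Real.pi, (‖f (r * exp (θ * I))‖ ^ 2 / 2 + (f (r * exp (θ * I)) ^ 2).re / 2) := by
    unfold cM
    congr 1; ext θ
    have hm : (r:ℂ) * exp (θ * I) ∈ ball (0:ℂ) R := by
      rw [mem_ball_zero_iff, norm_mul, norm_exp_ofReal_mul_I, mul_one]; exact hrR
    have hne : (r:ℂ) * exp (θ * I) ≠ 0 := mul_ne_zero (by exact_mod_cast h0.ne') (exp_ne_zero _)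
    rw [hu _ hm hne, ← normSq_eq_norm_sq, normSq_apply, pow_two (f _), mul_re]; ring
  rw [this, intervalIntegral.integral_add, intervalIntegral.integral_div, intervalIntegral.integral_div, hre]
  · ring
  · exact ((hc.norm.pow 2).div_const 2).intervalIntegrable _ _
  · exact ((continuous_re.comp (hc.pow 2)).div_const 2).intervalIntegrable _ _

open InnerProductSpace in
lemma cM_mono {u : ℂ → ℝ} {R r s : ℝ} (hu : HarmonicOnNhd u (ball 0 R)) (h0 : 0 < r) (hrs : r ≤ s)
    (hs : s < R) : cM u r ≤ cM u s := by
  obtain ⟨f, hf, hfu⟩ := hu.exists_analyticOnNhd_ball_re_eq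
  have hd := hf.differentiableOn
  have hu' : ∀ z ∈ ball (0:ℂ) R, z ≠ 0 → u z = (f z).re := fun z hz _ => (hfu hz).symm
  rw [cM_eq hd h0 (by linarith) hu', cM_eq hd (by linarith) hs hu']
  have := monoHol hd h0.le hrs hs
  linarith

open Complex in
lemma cM_div_mono {f : ℂ → ℂ} {u : ℂ → ℝ} {R r s : ℝ} (hf : DifferentiableOn ℂ f (ball 0 R))
    (hu : ∀ z ∈ ball (0:ℂ) R, z ≠ 0 → u z = (f z).re) (hf0 : f 0 = 0) (h0 : 0 < r) (hrs : r ≤ s)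
    (hs : s < R) : cM u r / r ^ 2 ≤ cM u s / s ^ 2 := by
  have hk : DifferentiableOn ℂ (dslope f 0) (ball 0 R) :=
    (Complex.differentiableOn_dslope (isOpen_ball.mem_nhds (by simp; linarith))).2 hf
  have key : ∀ t, 0 < t → t < R → cM u t / t ^ 2 =
      (∫ θ in (0:ℝ)..2 * Real.pi, ‖dslope f 0 (t * exp (θ * I))‖ ^ 2) / 2 := by
    intro t ht htR
    rw [cM_eq hf ht htR hu, hf0]
    have : ∀ θ : ℝ, ‖f (t * exp (θ * I))‖ ^ 2 = t ^ 2 * ‖dslope f 0 (t * exp (θ * I))‖ ^ 2 := by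
      intro θ
      have hne : (t:ℂ) * exp (θ * I) ≠ 0 := mul_ne_zero (by exact_mod_cast ht.ne') (exp_ne_zero _)
      have h1 := sub_smul_dslope f 0 (t * exp (θ * I))
      rw [hf0, sub_zero, sub_zero] at h1
      rw [← h1, norm_smul, norm_mul, norm_exp_ofReal_mul_I, norm_real, Real.norm_eq_abs, abs_of_pos ht]
      ring
    simp_rw [this]
    rw [intervalIntegral.integral_const_mul]
    have : t ^ 2 ≠ 0 := by positivity
    rw [mul_div_assoc, zero_pow two_ne_zero, zero_re, mul_zero, add_zero, mul_div_cancel_left₀ _ this]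
  rw [key r h0 (by linarith), key s (by linarith) hs]
  have := monoHol hk h0.le hrs hs
  linarith

open Complex InnerProductSpace in
lemma grad_bound {u : ℂ → ℝ} {w : ℂ} {r ε : ℝ} (hr : 0 < r) (hε : 0 < ε)
    (hu : HarmonicOnNhd u (ball w r)) (hb : ∀ z ∈ ball w r, |u z| ≤ ε) :
    ‖(fderiv ℝ u w 1 : ℂ) - I * fderiv ℝ u w I‖ ≤ 2 * Real.exp 2 * ε / r := by
  obtain ⟨F, hF, hFu⟩ := hu.exists_analyticOnNhd_ball_re_eq
  have hw : w ∈ ball w r := mem_ball_self hr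
  have hFd := (hF w hw).differentiableAt
  have hev : u =ᶠ[nhds w] fun z => (F z).re := by
    filter_upwards [isOpen_ball.mem_nhds hw] with z hz using (hFu hz).symm
  have hfd : fderiv ℝ u w = reCLM ∘L (fderiv ℝ F w) := by
    rw [hev.fderiv_eq]
    exact ((reCLM.hasFDerivAt).comp w (hFd.restrictScalars ℝ).hasFDerivAt).fderiv
  have hval : (fderiv ℝ u w 1 : ℂ) - I * fderiv ℝ u w I = deriv F w := by
    rw [hfd, hFd.fderiv_restrictScalars (𝕜 := ℝ)]
    apply Complex.ext <;> simp
  rw [hval]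
  set E : ℂ → ℂ := fun z => exp (F z / ε) with hE
  have hEd : DifferentiableOn ℂ E (ball w r) := (hF.differentiableOn.div_const _).cexp
  have hnE : ∀ z ∈ ball w r, ‖E z‖ = Real.exp (u z / ε) := by
    intro z hz
    rw [hE]; simp only [norm_exp]
    rw [div_ofReal_re, ← hFu hz]
  have h1 : ‖deriv E w‖ ≤ Real.exp 1 / (r / 2) := by
    apply Complex.norm_deriv_le_of_forall_mem_sphere_norm_le (by positivity)
    · apply DifferentiableOn.diffContOnCl
      rw [closure_ball _ (by positivity)]
      exact hEd.mono (closedBall_subset_ball (by linarith))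
    · intro z hz
      have hz' : z ∈ ball w r := by
        rw [mem_sphere] at hz; rw [mem_ball]; linarith
      rw [hnE z hz']
      apply Real.exp_le_exp.2
      rw [div_le_one hε]
      exact (le_abs_self _).trans (hb z hz')
  have h2 : deriv E w = E w * (deriv F w / ε) :=
    ((hFd.hasDerivAt.div_const (ε:ℂ)).cexp).deriv
  have h3 : Real.exp (-1) ≤ ‖E w‖ := by
    rw [hnE w hw]
    apply Real.exp_le_exp.2
    rw [le_div_iff₀ hε]
    linarith [neg_abs_le (u w), hb w hw]
  rw [h2, norm_mul, norm_div, norm_real, Real.norm_eq_abs, abs_of_pos hε] at h1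
  have h4 : Real.exp (-1) * (‖deriv F w‖ / ε) ≤ Real.exp 1 / (r / 2) :=
    (mul_le_mul_of_nonneg_right h3 (by positivity)).trans h1
  have e2 : Real.exp 2 = Real.exp 1 * Real.exp 1 := by rw [← Real.exp_add]; norm_num
  rw [Real.exp_neg, e2] at *
  have hp := Real.exp_pos 1
  rw [inv_mul_le_iff₀ hp, div_le_iff₀ hε] at h4
  calc _ ≤ _ := h4
    _ = _ := by field_simp

open Complex InnerProductSpace in
lemma removable {u : ℂ → ℝ} {R : ℝ} (hR : 0 < R) (hu : HarmonicOnNhd u (ball 0 R \ {0}))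
    (hl : Tendsto u (nhdsWithin 0 {0}ᶜ) (nhds 0)) :
    ∃ f : ℂ → ℂ, DifferentiableOn ℂ f (ball 0 R) ∧ f 0 = 0 ∧
      ∀ z ∈ ball (0:ℂ) R, z ≠ 0 → u z = (f z).re := by
  set q : ℂ → ℂ := fun z => (fderiv ℝ u z 1 : ℂ) - I * fderiv ℝ u z I with hq
  have h0 : ball (0:ℂ) R ∈ nhds 0 := isOpen_ball.mem_nhds (by simpa using hR)
  have hqd : DifferentiableOn ℂ q (ball 0 R \ {0}) := fun z hz =>
    (HarmonicAt.differentiableAt_complex_partial (hu z hz)).differentiableWithinAt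
  have hinv : Tendsto (fun z : ℂ => ‖z⁻¹‖) (nhdsWithin 0 {0}ᶜ) atTop := by
    exact tendsto_norm_cobounded_atTop.comp tendsto_inv₀_nhdsNE_zero
  have hlo : (fun z => q z - q 0) =o[nhdsWithin 0 {0}ᶜ] fun z => (z - 0)⁻¹ := by
    simp only [sub_zero]
    apply Asymptotics.IsLittleO.sub
    · rw [Asymptotics.isLittleO_iff]
      intro c hc
      set ε := c / (4 * Real.exp 2) with hεd
      have hε : 0 < ε := by positivity
      have hev : ∀ᶠ z in nhdsWithin (0:ℂ) {0}ᶜ, |u z| < ε := by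
        have := hl.abs
        rw [abs_zero] at this
        exact this.eventually_lt_const hε
      rw [eventually_nhdsWithin_iff, Metric.eventually_nhds_iff_ball] at hev
      obtain ⟨η, hη, hη'⟩ := hev
      rw [eventually_nhdsWithin_iff]
      have hm : 0 < min η R / 2 := by positivity
      filter_upwards [isOpen_ball.mem_nhds (mem_ball_self (x := (0:ℂ)) hm)] with z hz hz0
      rw [mem_ball_zero_iff] at hz
      have hzp : 0 < ‖z‖ := norm_pos_iff.2 hz0
      have hball : ∀ y ∈ ball z (‖z‖ / 2), ‖y‖ < min η R ∧ y ≠ 0 := by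
        intro y hy
        rw [mem_ball_iff_norm] at hy
        constructor
        · have := norm_le_norm_add_norm_sub' y z
          linarith
        · rintro rfl
          simp at hy; linarith
      have := grad_bound (u := u) (w := z) (r := ‖z‖ / 2) (by positivity) hε ?_ ?_
      · refine this.trans (le_of_eq ?_)
        rw [norm_inv, hεd]
        field_simp; norm_num
      · intro y hy
        obtain ⟨h1, h2⟩ := hball y hy
        exact hu y ⟨by rw [mem_ball_zero_iff]; exact h1.trans_le (min_le_right _ _), h2⟩
      · intro y hy
        obtain ⟨h1, h2⟩ := hball y hy
        exact (hη' y (by rw [mem_ball_zero_iff]; exact h1.trans_le (min_le_left _ _)) h2).le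
    · exact Asymptotics.isLittleO_const_left.2 (Or.inr hinv)
  have hqe := Complex.differentiableOn_update_limUnder_of_isLittleO h0 hqd hlo
  set Q := Function.update q 0 (limUnder (nhdsWithin 0 {0}ᶜ) q) with hQ
  obtain ⟨F, hF0, hF⟩ := hqe.isExactOn_ball.with_val_at 0 0
  have hFd : DifferentiableOn ℂ F (ball 0 R) := fun z hz => (hF z hz).differentiableAt.differentiableWithinAt
  have hUo : IsOpen (ball (0:ℂ) R \ {0}) := isOpen_ball.sdiff isClosed_singleton
  have hconn : IsPreconnected (ball (0:ℂ) R \ {0}) := by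
    have : ball (0:ℂ) R \ {0} = (fun p : ℝ × ℝ => (p.1 : ℂ) * exp (p.2 * I)) '' (Set.Ioo 0 R ×ˢ Set.univ) := by
      ext z
      constructor
      · rintro ⟨hz, hz0⟩
        refine ⟨(‖z‖, arg z), ⟨⟨norm_pos_iff.2 hz0, mem_ball_zero_iff.1 hz⟩, trivial⟩, ?_⟩
        exact norm_mul_exp_arg_mul_I z
      · rintro ⟨⟨a, b⟩, ⟨⟨h1, h2⟩, -⟩, rfl⟩
        refine ⟨?_, mul_ne_zero (by exact_mod_cast h1.ne') (exp_ne_zero _)⟩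
        simpa [norm_exp_ofReal_mul_I, abs_of_pos h1] using h2
    rw [this]
    apply IsPreconnected.image
    · exact isPreconnected_Ioo.prod isPreconnected_univ
    · fun_prop
  set v : ℂ → ℝ := fun z => (F z).re - u z with hv
  have hvd : ∀ z ∈ ball (0:ℂ) R \ {0}, HasFDerivAt v (0 : ℂ →L[ℝ] ℝ) z := by
    intro z hz
    have h1 := (hF z hz.1)
    have h2 := (reCLM.hasFDerivAt).comp z (h1.hasFDerivAt.restrictScalars ℝ)
    have h3 := ((hu z hz).1.differentiableAt two_ne_zero).hasFDerivAt
    have h4 := h2.sub h3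
    have hQz : Q z = q z := Function.update_of_ne hz.2 _ _
    have h5 : reCLM ∘L (ContinuousLinearMap.restrictScalars ℝ (ContinuousLinearMap.toSpanSingleton ℂ (Q z)))
        - fderiv ℝ u z = 0 := by
      ext a
      rw [hQz]
      have ha : fderiv ℝ u z a = a.re * fderiv ℝ u z 1 + a.im * fderiv ℝ u z I := by
        nth_rw 1 [(by simp : a = a.re • (1 : ℂ) + a.im • (I : ℂ))]
        rw [map_add, map_smul, map_smul]; simp
      simp [ha, hq]
    rw [h5] at h4
    exact h4
  have hconst : ∀ x ∈ ball (0:ℂ) R \ {0}, ∀ y ∈ ball (0:ℂ) R \ {0}, v x = v y := by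
    intro x hx y hy
    exact hUo.is_const_of_fderiv_eq_zero (𝕜 := ℝ) hconn (fun z hz => (hvd z hz).differentiableAt.differentiableWithinAt)
      (fun z hz => (hvd z hz).fderiv) hx hy
  have hvl : Tendsto v (nhdsWithin 0 {0}ᶜ) (nhds 0) := by
    have h1 : Tendsto F (nhdsWithin 0 {0}ᶜ) (nhds 0) := by
      have := (hF 0 (by simpa using hR)).continuousAt.tendsto
      rw [hF0] at this
      exact this.mono_left nhdsWithin_le_nhds
    have h2 := (continuous_re.tendsto 0).comp h1
    simpa using h2.sub hl
  refine ⟨F, hFd, hF0, fun z hz hz0 => ?_⟩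
  have : Tendsto v (nhdsWithin 0 {0}ᶜ) (nhds (v z)) := by
    apply tendsto_const_nhds.congr'
    filter_upwards [self_mem_nhdsWithin, mem_nhdsWithin_of_mem_nhds h0] with y hy hy'
    exact hconst z ⟨hz, hz0⟩ y ⟨hy', hy⟩
  have := tendsto_nhds_unique hvl this
  simp only [hv] at this
  linarith

open Complex InnerProductSpace in
lemma harm_inv {h : ℂ → ℝ} {w : ℂ} (hw : w ≠ 0) (hh : HarmonicAt h w⁻¹) :
    HarmonicAt (fun z => h z⁻¹) w := by
  obtain ⟨ε, h₁ε, h₂ε⟩ := isOpen_iff.1 (isOpen_setOfPred_harmonicAt (f := h)) w⁻¹ hh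
  obtain ⟨F, h₁F, h₂F⟩ := InnerProductSpace.HarmonicOnNhd.exists_analyticOnNhd_ball_re_eq
    (fun _ hy ↦ h₂ε hy)
  have hA : AnalyticAt ℂ (fun z => F z⁻¹) w :=
    (h₁F _ (mem_ball_self h₁ε)).fun_comp (analyticAt_inv hw)
  have := hA.harmonicAt_re
  refine (harmonicAt_congr_nhds ?_).1 this
  filter_upwards [(continuousAt_inv₀ hw).preimage_mem_nhds (ball_mem_nhds _ h₁ε)] with z hz
  exact h₂F hz

open Complex in
lemma cM_inv (h : ℂ → ℝ) (t : ℝ) : cM (fun z => h z⁻¹) t = cM h t⁻¹ := by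
  unfold cM
  have h1 : ∀ θ : ℝ, h ((t:ℂ) * exp (θ * I))⁻¹ ^ 2 =
      (fun x : ℝ => h (((t⁻¹:ℝ):ℂ) * exp (x * I)) ^ 2) (2 * Real.pi - θ) := by
    intro θ
    have : exp (((2 * Real.pi - θ : ℝ):ℂ) * I) = (exp (θ * I))⁻¹ := by
      push_cast; rw [sub_mul, exp_sub, exp_two_pi_mul_I, one_div]
    simp only [this, mul_inv, ofReal_inv]
  simp_rw [h1]
  rw [intervalIntegral.integral_comp_sub_left (fun x : ℝ => h (((t⁻¹:ℝ):ℂ) * exp (x * I)) ^ 2)]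
  simp

open Complex InnerProductSpace in
lemma ext_anti {h : ℂ → ℝ} {a r s : ℝ} (ha : 0 < a) (hh : HarmonicOnNhd h {z | a < ‖z‖})
    (hl : Tendsto h (Bornology.cobounded ℂ) (nhds 0)) (hr : a < r) (hrs : r ≤ s) :
    s ^ 2 * cM h s ≤ r ^ 2 * cM h r := by
  have hr0 : 0 < r := ha.trans hr
  have hs0 : 0 < s := hr0.trans_le hrs
  have H1 : HarmonicOnNhd (fun z => h z⁻¹) (ball 0 a⁻¹ \ {0}) := by
    rintro w ⟨hw, hw0⟩
    apply harm_inv hw0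
    apply hh
    rw [mem_ball_zero_iff] at hw
    have : 0 < ‖w‖ := norm_pos_iff.2 hw0
    simp only [Set.mem_ofPred_eq, norm_inv]
    exact (lt_inv_comm₀ this ha).1 hw
  have H2 : Tendsto (fun z => h z⁻¹) (nhdsWithin 0 {0}ᶜ) (nhds 0) := hl.comp tendsto_inv₀_nhdsNE_zero
  obtain ⟨f, hf, hf0, hfu⟩ := removable (by positivity) H1 H2
  have := cM_div_mono hf hfu hf0 (r := s⁻¹) (s := r⁻¹) (by positivity) (by gcongr) (by gcongr)
  rw [cM_inv, cM_inv, inv_inv, inv_inv] at this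
  simp only [inv_pow, div_inv_eq_mul] at this
  linarith

open Complex in
lemma polar {u : ℂ → ℝ} {S : Set ℝ} (hS : MeasurableSet S) (hSp : S ⊆ Set.Ioi 0)
    (hu : ContinuousOn u {z | ‖z‖ ∈ S}) :
    ∫⁻ z in {z : ℂ | ‖z‖ ∈ S}, ENNReal.ofReal (u z ^ 2) = ∫⁻ r in S, ENNReal.ofReal (r * cM u r) := by
  have hT : MeasurableSet {z : ℂ | ‖z‖ ∈ S} := measurable_norm hS
  have hum : Measurable ({z | ‖z‖ ∈ S}.indicator u) := by
    classical
    rw [← Set.piecewise_eq_indicator]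
    exact ContinuousOn.measurable_piecewise hu continuousOn_const hT
  set v := {z : ℂ | ‖z‖ ∈ S}.indicator u with hv
  have e0 : ∀ z, ({z : ℂ | ‖z‖ ∈ S}.indicator (fun z => ENNReal.ofReal (u z ^ 2))) z = ENNReal.ofReal (v z ^ 2) := by
    intro z
    by_cases hz : z ∈ {z : ℂ | ‖z‖ ∈ S} <;> simp [hv, hz]
  rw [← lintegral_indicator hT]
  simp_rw [e0]
  rw [← Complex.lintegral_comp_polarCoord_symm]
  have e1 : polarCoord.target = Set.Ioi (0:ℝ) ×ˢ Set.Ioo (-Real.pi) Real.pi := rfl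
  have hmeas : Measurable (fun p : ℝ × ℝ => ENNReal.ofReal p.1 • ENNReal.ofReal (v (Complex.polarCoord.symm p) ^ 2)) := by
    have : Measurable (fun p : ℝ × ℝ => (Complex.polarCoord.symm p)) := by
      simp only [Complex.polarCoord_symm_apply]; fun_prop
    exact (measurable_fst.ennreal_ofReal).smul ((hum.comp this).pow_const 2).ennreal_ofReal
  rw [e1, Measure.volume_eq_prod, ← Measure.prod_restrict, lintegral_prod _ hmeas.aemeasurable]
  have e2 : ∀ r ∈ Set.Ioi (0:ℝ), ∫⁻ θ in Set.Ioo (-Real.pi) Real.pi,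
      ENNReal.ofReal r • ENNReal.ofReal (v (Complex.polarCoord.symm (r, θ)) ^ 2) =
      S.indicator (fun r => ENNReal.ofReal (r * cM u r)) r := by
    intro r hr
    have hr : 0 < r := hr
    have hpt : ∀ θ : ℝ, Complex.polarCoord.symm (r, θ) = r * exp (θ * I) := by
      intro θ
      rw [Complex.polarCoord_symm_apply, exp_mul_I]; simp
    have hnorm : ∀ θ : ℝ, ‖(r:ℂ) * exp (θ * I)‖ = r := by
      intro θ; simp [norm_exp_ofReal_mul_I, abs_of_pos hr]
    by_cases hrS : r ∈ S
    · have e3 : ∀ θ : ℝ, v (Complex.polarCoord.symm (r, θ)) = u (r * exp (θ * I)) := by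
        intro θ
        rw [hpt, hv, Set.indicator_of_mem]
        rw [Set.mem_ofPred_eq, hnorm]; exact hrS
      simp_rw [e3]
      have hcont : Continuous (fun θ : ℝ => u (r * exp (θ * I)) ^ 2) := by
        refine Continuous.pow ?_ 2
        exact hu.comp_continuous (by fun_prop) (fun θ => by rw [Set.mem_ofPred_eq, hnorm]; exact hrS)
      rw [Set.indicator_of_mem hrS]
      simp only [smul_eq_mul]
      rw [lintegral_const_mul _ hcont.measurable.ennreal_ofReal, ENNReal.ofReal_mul hr.le]
      congr 1
      have hp : Function.Periodic (fun θ : ℝ => u (r * exp (θ * I)) ^ 2) (2 * Real.pi) := by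
        intro θ
        have : exp (((θ + 2 * Real.pi : ℝ):ℂ) * I) = exp (θ * I) := by
          push_cast; rw [add_mul, exp_add, exp_two_pi_mul_I, mul_one]
        simp only [this]
      have h3 := hp.intervalIntegral_add_eq (-Real.pi) 0
      have h4 : -Real.pi + 2 * Real.pi = Real.pi := by ring
      rw [h4, zero_add] at h3
      rw [cM, ← h3, intervalIntegral.integral_of_le (by linarith [Real.pi_pos]), 
        integral_Ioc_eq_integral_Ioo, ofReal_integral_eq_lintegral_ofReal]
      · exact (hcont.integrableOn_Icc).mono_set Set.Ioo_subset_Icc_self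
      · exact ae_of_all _ fun _ => by positivity
    · rw [Set.indicator_of_notMem hrS]
      have e3 : ∀ θ : ℝ, v (Complex.polarCoord.symm (r, θ)) = 0 := by
        intro θ
        rw [hpt, hv, Set.indicator_of_notMem]
        rw [Set.mem_ofPred_eq, hnorm]; exact hrS
      simp only [e3]; simp
  rw [setLIntegral_congr_fun measurableSet_Ioi e2, setLIntegral_indicator hS,
    Set.inter_eq_left.2 hSp]

lemma lint_le {φ Φ : ℝ → ℝ} {a b : ℝ} {S : Set ℝ} (hab : a ≤ b) (hS : S = Set.Ico a b ∨ S = Set.Ioo a b)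
    (hΦ : ∀ x ∈ Set.Icc a b, HasDerivAt Φ (φ x) x) (hφ : ContinuousOn φ (Set.Icc a b))
    (h0 : ∀ x ∈ Set.Icc a b, 0 ≤ φ x) :
    ∫⁻ x in S, ENNReal.ofReal (φ x) = ENNReal.ofReal (Φ b - Φ a) := by
  have hSs : ∫⁻ x in S, ENNReal.ofReal (φ x) = ∫⁻ x in Set.Ioc a b, ENNReal.ofReal (φ x) := by
    apply setLIntegral_congr
    rcases hS with rfl | rfl
    · exact Ico_ae_eq_Ioc
    · exact Ioo_ae_eq_Ioc
  rw [hSs, ← ofReal_integral_eq_lintegral_ofReal, ← intervalIntegral.integral_of_le hab,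
    intervalIntegral.integral_eq_sub_of_hasDerivAt]
  · rwa [Set.uIcc_of_le hab]
  · exact hφ.intervalIntegrable_of_Icc hab
  · exact (hφ.integrableOn_Icc).mono_set Set.Ioc_subset_Icc_self
  · filter_upwards [ae_restrict_mem measurableSet_Ioc] with x hx using h0 x (Set.Ioc_subset_Icc_self hx)

lemma cM_nonneg (u : ℂ → ℝ) (r : ℝ) : 0 ≤ cM u r :=
  intervalIntegral.integral_nonneg (by positivity) (fun _ _ => by positivity)

lemma up1 {m : ℝ → ℝ} {a b C : ℝ} {S : Set ℝ} (ha : 0 ≤ a) (hab : a ≤ b) (hC : 0 ≤ C)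
    (hS : S = Set.Ico a b ∨ S = Set.Ioo a b) (hm : ∀ r ∈ S, m r ≤ C) :
    ∫⁻ r in S, ENNReal.ofReal (r * m r) ≤ ENNReal.ofReal (C / 2 * (b ^ 2 - a ^ 2)) := by
  have hSm : MeasurableSet S := by rcases hS with rfl | rfl <;> measurability
  have hSa : ∀ r ∈ S, a ≤ r := by
    rcases hS with rfl | rfl
    · exact fun r hr => hr.1
    · exact fun r hr => hr.1.le
  have := lint_le (φ := fun r => r * C) (Φ := fun r => C / 2 * r ^ 2) hab hS
    (fun x _ => by
      have := (hasDerivAt_pow 2 x).const_mul (C / 2)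
      refine this.congr_deriv ?_; push_cast; ring) (by fun_prop) (fun x hx => mul_nonneg (ha.trans hx.1) hC)
  rw [mul_sub, ← this]
  apply setLIntegral_mono' hSm
  intro r hr
  exact ENNReal.ofReal_le_ofReal (mul_le_mul_of_nonneg_left (hm r hr) (ha.trans (hSa r hr)))

lemma lo1 {m : ℝ → ℝ} {a b C : ℝ} {S : Set ℝ} (ha : 0 ≤ a) (hab : a ≤ b) (hC : 0 ≤ C)
    (hS : S = Set.Ico a b ∨ S = Set.Ioo a b) (hm : ∀ r ∈ S, C ≤ m r) :
    ENNReal.ofReal (C / 2 * (b ^ 2 - a ^ 2)) ≤ ∫⁻ r in S, ENNReal.ofReal (r * m r) := by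
  have hSm : MeasurableSet S := by rcases hS with rfl | rfl <;> measurability
  have hSa : ∀ r ∈ S, a ≤ r := by
    rcases hS with rfl | rfl
    · exact fun r hr => hr.1
    · exact fun r hr => hr.1.le
  have := lint_le (φ := fun r => r * C) (Φ := fun r => C / 2 * r ^ 2) hab hS
    (fun x _ => by
      have := (hasDerivAt_pow 2 x).const_mul (C / 2)
      refine this.congr_deriv ?_; push_cast; ring) (by fun_prop) (fun x hx => mul_nonneg (ha.trans hx.1) hC)
  rw [mul_sub, ← this]
  apply setLIntegral_mono' hSm
  intro r hr
  exact ENNReal.ofReal_le_ofReal (mul_le_mul_of_nonneg_left (hm r hr) (ha.trans (hSa r hr)))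

lemma lintInv {a b C : ℝ} {S : Set ℝ} (ha : 0 < a) (hab : a ≤ b) (hC : 0 ≤ C)
    (hS : S = Set.Ico a b ∨ S = Set.Ioo a b) :
    ∫⁻ r in S, ENNReal.ofReal (C * r⁻¹) = ENNReal.ofReal (C * (Real.log b - Real.log a)) := by
  rw [mul_sub]
  refine lint_le (φ := fun r => C * r⁻¹) (Φ := fun r => C * Real.log r) hab hS ?_ ?_ ?_
  · intro x hx
    exact (Real.hasDerivAt_log (ha.trans_le hx.1).ne').const_mul C
  · exact continuousOn_const.mul (continuousOn_inv₀.mono fun x hx => (ha.trans_le hx.1).ne')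
  · intro x hx
    have := ha.trans_le hx.1
    positivity

lemma cross {A B : ENNReal} {C α β : ℝ} (hC : 0 ≤ C) (hα : 0 ≤ α) (hβ : 0 ≤ β)
    (h1 : A ≤ ENNReal.ofReal (C * α)) (h2 : ENNReal.ofReal (C * β) ≤ B) :
    A * ENNReal.ofReal β ≤ ENNReal.ofReal α * B := by
  calc A * ENNReal.ofReal β ≤ ENNReal.ofReal (C * α) * ENNReal.ofReal β := by gcongr
    _ = ENNReal.ofReal α * ENNReal.ofReal (C * β) := by
      rw [← ENNReal.ofReal_mul (by positivity), ← ENNReal.ofReal_mul (by positivity)]; congr 1; ring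
    _ ≤ _ := by gcongr

open InnerProductSpace in
lemma gIneq {u : ℂ → ℝ} {Rm Rp Ri : ℝ} (hu : HarmonicOnNhd u (ball 0 Ri)) (h0 : 0 < Rm) (h1 : Rm < Rp)
    (h2 : Rp < Ri) :
    (∫⁻ z in {z : ℂ | ‖z‖ ∈ Set.Ioo 0 Rp}, ENNReal.ofReal (u z ^ 2)) * ENNReal.ofReal (Ri ^ 2 - Rm ^ 2) ≤
      ENNReal.ofReal (Rp ^ 2) * ∫⁻ z in {z : ℂ | ‖z‖ ∈ Set.Ico Rm Ri}, ENNReal.ofReal (u z ^ 2) := by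
  have hc := hu.continuousOn
  rw [polar measurableSet_Ioo (fun x hx => hx.1)
      (hc.mono fun z hz => by rw [mem_ball_zero_iff]; exact hz.2.trans h2),
    polar measurableSet_Ico (fun x hx => h0.trans_le hx.1)
      (hc.mono fun z hz => by rw [mem_ball_zero_iff]; exact hz.2)]
  have s1 : Set.Ioo 0 Rp = Set.Ioo 0 Rm ∪ Set.Ico Rm Rp := (Set.Ioo_union_Ico_eq_Ioo h0 h1.le).symm
  have s2 : Set.Ico Rm Ri = Set.Ico Rm Rp ∪ Set.Ico Rp Ri := (Set.Ico_union_Ico_eq_Ico h1.le h2.le).symm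
  rw [s1, s2, lintegral_union measurableSet_Ico, lintegral_union measurableSet_Ico]
  rotate_left
  · rw [Set.disjoint_left]; intro x hx hx'; exact absurd hx.2 (not_lt.2 hx'.1)
  · rw [Set.disjoint_left]; intro x hx hx'; exact absurd hx.2 (not_lt.2 hx'.1)
  set A1 := ∫⁻ r in Set.Ioo 0 Rm, ENNReal.ofReal (r * cM u r)
  set A2 := ∫⁻ r in Set.Ico Rm Rp, ENNReal.ofReal (r * cM u r)
  set A3 := ∫⁻ r in Set.Ico Rp Ri, ENNReal.ofReal (r * cM u r)
  have c1 := cM_nonneg u Rm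
  have c2 := cM_nonneg u Rp
  have hx : 0 ≤ Rm ^ 2 - 0 ^ 2 := by nlinarith
  have hp : 0 ≤ Rp ^ 2 - Rm ^ 2 := by nlinarith
  have hq : 0 ≤ Ri ^ 2 - Rp ^ 2 := by nlinarith
  have u1 : A1 ≤ ENNReal.ofReal (cM u Rm / 2 * (Rm ^ 2 - 0 ^ 2)) :=
    up1 le_rfl h0.le c1 (Or.inr rfl) fun r hr => cM_mono hu hr.1 hr.2.le (h1.trans h2)
  have u1' : A1 ≤ ENNReal.ofReal (cM u Rp / 2 * (Rm ^ 2 - 0 ^ 2)) :=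
    up1 le_rfl h0.le c2 (Or.inr rfl) fun r hr => cM_mono hu hr.1 (hr.2.le.trans h1.le) h2
  have u2 : A2 ≤ ENNReal.ofReal (cM u Rp / 2 * (Rp ^ 2 - Rm ^ 2)) :=
    up1 h0.le h1.le c2 (Or.inl rfl) fun r hr => cM_mono hu (h0.trans_le hr.1) hr.2.le h2
  have l2 : ENNReal.ofReal (cM u Rm / 2 * (Rp ^ 2 - Rm ^ 2)) ≤ A2 :=
    lo1 h0.le h1.le c1 (Or.inl rfl) fun r hr => cM_mono hu h0 hr.1 (hr.2.trans h2)
  have l3 : ENNReal.ofReal (cM u Rp / 2 * (Ri ^ 2 - Rp ^ 2)) ≤ A3 :=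
    lo1 (h0.trans h1).le h2.le c2 (Or.inl rfl) fun r hr => cM_mono hu (h0.trans h1) hr.1 hr.2
  have k1 := cross (by positivity) hx hp u1 l2
  have k2 := cross (by positivity) hx hq u1' l3
  have k3 := cross (by positivity) hp hq u2 l3
  have e1 : ENNReal.ofReal (Ri ^ 2 - Rm ^ 2) = ENNReal.ofReal (Rp ^ 2 - Rm ^ 2) + ENNReal.ofReal (Ri ^ 2 - Rp ^ 2) := by
    rw [← ENNReal.ofReal_add hp hq]; congr 1; ring
  have e2 : ENNReal.ofReal (Rp ^ 2) = ENNReal.ofReal (Rm ^ 2 - 0 ^ 2) + ENNReal.ofReal (Rp ^ 2 - Rm ^ 2) := by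
    rw [← ENNReal.ofReal_add hx hp]; congr 1; ring
  rw [e1, e2]
  set x := ENNReal.ofReal (Rm ^ 2 - 0 ^ 2)
  set p := ENNReal.ofReal (Rp ^ 2 - Rm ^ 2)
  set q := ENNReal.ofReal (Ri ^ 2 - Rp ^ 2)
  calc (A1 + A2) * (p + q) = A1 * p + A1 * q + A2 * q + p * A2 := by ring
    _ ≤ x * A2 + x * A3 + p * A3 + p * A2 := by gcongr
    _ = _ := by ring

open InnerProductSpace in
lemma hIneq {u : ℂ → ℝ} {Rm Rp Re δ : ℝ} (hu : HarmonicOnNhd u {z | Rm < ‖z‖})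
    (hl : Tendsto u (Bornology.cobounded ℂ) (nhds 0)) (h0 : 0 < Rm) (h1 : Rm < Rp)
    (h2 : Rp < Re) (hδ : 1 < δ) (d1 : Real.log Re - Real.log Rp = δ)
    (d2 : Real.log Rp - Real.log Rm = δ * (δ - 1)) :
    (∫⁻ z in {z : ℂ | ‖z‖ ∈ Set.Ico Rp Re}, ENNReal.ofReal (u z ^ 2)) * ENNReal.ofReal (δ - 1) ≤
      ∫⁻ z in {z : ℂ | ‖z‖ ∈ Set.Ioo Rm Rp}, ENNReal.ofReal (u z ^ 2) := by
  have hc := hu.continuousOn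
  have hp0 := h0.trans h1
  rw [polar measurableSet_Ico (fun x hx => hp0.trans_le hx.1)
      (hc.mono fun z hz => h1.trans_le hz.1),
    polar measurableSet_Ioo (fun x hx => h0.trans hx.1)
      (hc.mono fun z hz => hz.1)]
  set P := Rp ^ 2 * cM u Rp
  have hP : 0 ≤ P := mul_nonneg (by positivity) (cM_nonneg _ _)
  have ef : ∀ r, 0 < r → r * cM u r = r ^ 2 * cM u r * r⁻¹ := by
    intro r hr; field_simp
  have a1 : ∫⁻ r in Set.Ico Rp Re, ENNReal.ofReal (r * cM u r) ≤ ENNReal.ofReal (P * δ) := by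
    rw [← d1, ← lintInv hp0 h2.le hP (Or.inl rfl)]
    apply setLIntegral_mono' measurableSet_Ico
    intro r hr
    have hr0 := hp0.trans_le hr.1
    rw [ef r hr0]
    apply ENNReal.ofReal_le_ofReal
    exact mul_le_mul_of_nonneg_right (ext_anti h0 hu hl h1 hr.1) (by positivity)
  have a2 : ENNReal.ofReal (P * (δ * (δ - 1))) ≤ ∫⁻ r in Set.Ioo Rm Rp, ENNReal.ofReal (r * cM u r) := by
    rw [← d2, ← lintInv h0 h1.le hP (Or.inr rfl)]
    apply setLIntegral_mono' measurableSet_Ioo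
    intro r hr
    have hr0 := h0.trans hr.1
    rw [ef r hr0]
    apply ENNReal.ofReal_le_ofReal
    exact mul_le_mul_of_nonneg_right (ext_anti h0 hu hl hr.1 hr.2.le) (by positivity)
  have := cross (A := ∫⁻ r in Set.Ico Rp Re, ENNReal.ofReal (r * cM u r)) (C := P * δ) (α := 1) (β := δ - 1)
    (by positivity) zero_le_one (by linarith) (by rwa [mul_one]) (B := ∫⁻ r in Set.Ioo Rm Rp, ENNReal.ofReal (r * cM u r)) (by rwa [mul_assoc])
  simpa using this

/-- the isometric chart of the plane centered at `c` -/
def chart (c : Pt) (z : ℂ) : Pt := c + Complex.orthonormalBasisOneI.repr z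

lemma chart_mp (c : Pt) : MeasurePreserving (chart c) volume volume :=
  (measurePreserving_add_left volume c).comp (LinearIsometryEquiv.measurePreserving Complex.orthonormalBasisOneI.repr)

lemma chart_emb (c : Pt) : MeasurableEmbedding (chart c) :=
  (measurableEmbedding_addLeft c).comp
    (Complex.orthonormalBasisOneI.repr.toHomeomorph.measurableEmbedding)

lemma chart_dist (c : Pt) (z : ℂ) : dist (chart c z) c = ‖z‖ := by
  simp [chart, dist_eq_norm]

lemma chart_cont (c : Pt) : Continuous (chart c) := by
  unfold chart; fun_prop

open InnerProductSpace in
lemma chart_harm {g : Pt → ℝ} {U : Set Pt} (hU : IsOpen U) (hg : IsHarmonicOn g U) (c : Pt) {z : ℂ}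
    (hz : chart c z ∈ U) : HarmonicAt (fun w => g (chart c w)) z := by
  have hV : IsOpen (chart c ⁻¹' U) := hU.preimage (chart_cont c)
  have hcd : ContDiff ℝ 2 (chart c) := by
    unfold chart
    exact contDiff_const.add Complex.orthonormalBasisOneI.repr.contDiff
  have hCD : ∀ w, chart c w ∈ U → ContDiffAt ℝ 2 g (chart c w) := fun w hw => hg.1.contDiffAt (hU.mem_nhds hw)
  refine ⟨(hCD z hz).comp z hcd.contDiffAt, ?_⟩
  filter_upwards [hV.mem_nhds hz] with w hw
  rw [laplacian_eq_iteratedFDeriv_complexPlane]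
  have h1 : iteratedFDeriv ℝ 2 (fun w => g (chart c w)) w =
      (iteratedFDeriv ℝ 2 g (chart c w)).compContinuousLinearMap
        (fun _ => (Complex.orthonormalBasisOneI.repr.toContinuousLinearEquiv : ℂ →L[ℝ] Pt)) := by
    have h2 := ContinuousLinearEquiv.iteratedFDerivWithin_comp_right
      Complex.orthonormalBasisOneI.repr.toContinuousLinearEquiv
      (fun y : Pt => g (c + y)) (s := Set.univ) uniqueDiffOn_univ (x := w) (Set.mem_univ _) 2
    rw [Set.preimage_univ, iteratedFDerivWithin_univ, iteratedFDerivWithin_univ,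
      iteratedFDeriv_comp_add_left] at h2
    exact h2
  have h3 := hg.2 _ hw
  rw [lap, Fin.sum_univ_two] at h3
  simp only [h1, ContinuousMultilinearMap.compContinuousLinearMap_apply, Pi.zero_apply]
  have b0 : Complex.orthonormalBasisOneI.repr (1:ℂ) = EuclideanSpace.single 0 (1:ℝ) := by
    have := Complex.orthonormalBasisOneI.repr_self 0
    simpa using this
  have b1 : Complex.orthonormalBasisOneI.repr Complex.I = EuclideanSpace.single 1 (1:ℝ) := by
    have := Complex.orthonormalBasisOneI.repr_self 1
    simpa using this
  rw [← h3]
  congr 2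
  · ext i : 1
    fin_cases i <;> exact b0
  · ext i : 1
    fin_cases i <;> exact b1

lemma chart_lint (c : Pt) (g : Pt → ℝ) (S : Set ℝ) :
    ∫⁻ x in {x : Pt | dist x c ∈ S}, ENNReal.ofReal (g x ^ 2) =
      ∫⁻ z in {z : ℂ | ‖z‖ ∈ S}, ENNReal.ofReal (g (chart c z) ^ 2) := by
  rw [← (chart_mp c).setLIntegral_comp_preimage_emb (chart_emb c)]
  congr 2
  ext z
  simp [chart_dist]

lemma eL2 (g : Pt → ℝ) (μ : Measure Pt) :
    eLpNorm g 2 μ = (∫⁻ x, ENNReal.ofReal (g x ^ 2) ∂μ) ^ (1 / 2 : ℝ) := by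
  rw [eLpNorm_eq_lintegral_rpow_enorm_toReal (by norm_num) (by norm_num)]
  have : ∀ x, ‖g x‖ₑ ^ (2:ENNReal).toReal = ENNReal.ofReal (g x ^ 2) := by
    intro x
    rw [ENNReal.toReal_ofNat, ENNReal.rpow_ofNat, Real.enorm_eq_ofReal_abs, ← ENNReal.ofReal_pow (abs_nonneg _), sq_abs]
  simp_rw [this]
  norm_num

lemma sqrt_step {N1 N : ENNReal} {n d : ℝ} (hn : 0 ≤ n) (hd : 0 < d)
    (h : N1 * ENNReal.ofReal d ≤ ENNReal.ofReal n * N) :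
    N1 ^ (1 / 2 : ℝ) ≤ ENNReal.ofReal (Real.sqrt (n / d)) * N ^ (1 / 2 : ℝ) := by
  have h1 : N1 ≤ ENNReal.ofReal (n / d) * N := by
    rw [ENNReal.ofReal_div_of_pos hd, ENNReal.div_eq_inv_mul, mul_assoc, ← ENNReal.div_eq_inv_mul]
    rwa [ENNReal.le_div_iff_mul_le (Or.inl (by simpa using hd)) (Or.inl ENNReal.ofReal_ne_top)]
  rw [Real.sqrt_eq_rpow, ← ENNReal.ofReal_rpow_of_nonneg (by positivity) (by norm_num),
    ← ENNReal.mul_rpow_of_nonneg _ _ (by norm_num)]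
  exact ENNReal.rpow_le_rpow h1 (by norm_num)

lemma CS {g h : Pt → ℝ} {μ : Measure Pt} (hg : AEStronglyMeasurable g μ) (hh : AEStronglyMeasurable h μ) :
    ∫⁻ x, ‖g x * h x‖ₑ ∂μ ≤ eLpNorm g 2 μ * eLpNorm h 2 μ := by
  have := eLpNorm_smul_le_mul_eLpNorm (p := 2) (q := 2) (r := 1) hh hg
  rw [eLpNorm_one_eq_lintegral_enorm] at this
  simpa using this

theorem stmt9 (𝒢 𝒪 : Set Pt) (c : Pt) (Re Ri Rp Rm δ δ₀ : ℝ)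
    (geom : Geometry 𝒢 𝒪 c Re Ri Rp Rm δ δ₀)
    (g : Pt → ℝ) (hg : IsHarmonicOn g 𝒢) (hgL2 : IntegrableOn (fun x => g x ^ 2) 𝒢)
    (h : Pt → ℝ) (hh : IsHarmonicOn h (closure 𝒪)ᶜ)
    (hloc : LocallyIntegrableOn (fun x => h x ^ 2) (closure 𝒪)ᶜ)
    (hlim : Tendsto h (cocompact Pt) (nhds 0)) :
    ENNReal.ofReal |∫ x in 𝒢 \ closure 𝒪, g x * h x|
      ≤ ENNReal.ofReal (Real.sqrt (Rp ^ 2 / (Ri ^ 2 - Rm ^ 2)) + Real.sqrt (1 / δ))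
          * (eLpNorm g 2 (volume.restrict (𝒢 \ closure 𝒪))
              * eLpNorm h 2 (volume.restrict (𝒢 \ closure 𝒪))) := by
  obtain ⟨openG, openO, bddG, bddO, scG, scO, clO_sub_G, h0, h1, h2, h3, clG_sub, clDi_sub, clDp_sub, clDm_sub,
    clO_sub, Rm_eq, Rp_eq, δ₀_eq, δ₀_lt⟩ := geom
  have hp0 := h0.trans h1
  have hi0 := hp0.trans h2
  have he0 := hi0.trans h3
  have hδ : 1 < δ := by
    have : 0 < Real.log (Re / Ri) := Real.log_pos (by rw [one_lt_div hi0]; exact h3)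
    linarith
  have lm : Real.log Rm = Real.log Re - δ ^ 2 := by
    rw [Rm_eq, Real.log_mul he0.ne' (Real.exp_ne_zero _), Real.log_exp]; ring
  have lp : Real.log Rp = Real.log Re - δ := by
    rw [Rp_eq, Real.log_mul he0.ne' (Real.exp_ne_zero _), Real.log_exp]; ring
  have openK : IsOpen (closure 𝒪)ᶜ := isClosed_closure.isOpen_compl
  set F := 𝒢 \ closure 𝒪 with hF
  have openF : IsOpen F := openG.sdiff isClosed_closure
  have hFm := openF.measurableSet
  have hgm : AEStronglyMeasurable g (volume.restrict F) :=
    (hg.1.continuousOn.mono Set.sdiff_subset).aestronglyMeasurable hFm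
  have hhm : AEStronglyMeasurable h (volume.restrict F) :=
    (hh.1.continuousOn.mono fun x hx => hx.2).aestronglyMeasurable hFm
  have outO : ∀ x, Rm ≤ dist x c → x ∈ (closure 𝒪)ᶜ := fun x hx hxO =>
    absurd (mem_ball.1 (clO_sub hxO)) (not_lt.2 hx)
  have inG : ∀ x, dist x c ≤ Ri → x ∈ 𝒢 := fun x hx => clDi_sub (mem_closedBall.2 hx)
  set F1 := F ∩ ball c Rp with hF1
  set F2 := F \ ball c Rp with hF2
  have kg : (∫⁻ x in F1, ENNReal.ofReal (g x ^ 2)) * ENNReal.ofReal (Ri ^ 2 - Rm ^ 2) ≤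
      ENNReal.ofReal (Rp ^ 2) * ∫⁻ x in F, ENNReal.ofReal (g x ^ 2) := by
    have hu : InnerProductSpace.HarmonicOnNhd (fun z => g (chart c z)) (ball 0 Ri) := by
      intro z hz
      apply chart_harm openG hg
      apply inG
      rw [chart_dist]; exact (mem_ball_zero_iff.1 hz).le
    have key := gIneq hu h0 h1 h2
    rw [← chart_lint, ← chart_lint] at key
    calc _ ≤ (∫⁻ x in {x : Pt | dist x c ∈ Set.Ioo 0 Rp}, ENNReal.ofReal (g x ^ 2)) * ENNReal.ofReal (Ri ^ 2 - Rm ^ 2) := by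
          gcongr ?_ * _
          apply lintegral_mono_set'
          have : ∀ᵐ x : Pt, x ≠ c := by simp [ae_iff]
          filter_upwards [this] with x hx hx1
          exact ⟨dist_pos.2 hx, mem_ball.1 hx1.2⟩
      _ ≤ _ := key
      _ ≤ _ := by
          gcongr _ * ?_
          apply lintegral_mono_set
          intro x hx
          exact ⟨inG x hx.2.le, outO x hx.1⟩
  have kh : (∫⁻ x in F2, ENNReal.ofReal (h x ^ 2)) * ENNReal.ofReal δ ≤
      ENNReal.ofReal 1 * ∫⁻ x in F, ENNReal.ofReal (h x ^ 2) := by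
    have hu : InnerProductSpace.HarmonicOnNhd (fun z => h (chart c z)) {z | Rm < ‖z‖} := by
      intro z hz
      apply chart_harm openK hh
      apply outO
      rw [chart_dist]; exact le_of_lt hz
    have hl : Tendsto (fun z => h (chart c z)) (Bornology.cobounded ℂ) (nhds 0) := by
      refine hlim.comp ?_
      rw [← Metric.cobounded_eq_cocompact, ← tendsto_dist_right_atTop_iff c]
      simp only [chart_dist]
      exact tendsto_norm_cobounded_atTop
    have key := hIneq hu hl h0 h1 (h2.trans h3) hδ (by rw [lp]; ring) (by rw [lp, lm]; ring)
    rw [← chart_lint, ← chart_lint] at key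
    have hA : ∫⁻ x in F2, ENNReal.ofReal (h x ^ 2) ≤
        ∫⁻ x in {x : Pt | dist x c ∈ Set.Ico Rp Re}, ENNReal.ofReal (h x ^ 2) := by
      apply lintegral_mono_set
      intro x hx
      exact ⟨not_lt.1 fun hlt => hx.2 (mem_ball.2 hlt), mem_ball.1 (clG_sub (subset_closure hx.1.1))⟩
    have hB : ∫⁻ x in {x : Pt | dist x c ∈ Set.Ioo Rm Rp}, ENNReal.ofReal (h x ^ 2) ≤
        ∫⁻ x in F1, ENNReal.ofReal (h x ^ 2) := by
      apply lintegral_mono_set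
      intro x hx
      exact ⟨⟨inG x (hx.2.trans h2).le, outO x hx.1.le⟩, mem_ball.2 hx.2⟩
    have e : ENNReal.ofReal δ = ENNReal.ofReal (δ - 1) + 1 := by
      rw [← ENNReal.ofReal_one, ← ENNReal.ofReal_add (by linarith) zero_le_one]; congr 1; ring
    rw [e, mul_add, mul_one, ENNReal.ofReal_one, one_mul,
      ← lintegral_inter_add_sdiff (μ := volume) (fun x => ENNReal.ofReal (h x ^ 2)) F (measurableSet_ball (x := c) (ε := Rp))]
    gcongr
    calc _ ≤ _ := by gcongr
      _ ≤ _ := key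
      _ ≤ _ := hB
  have ng : eLpNorm g 2 (volume.restrict F1) ≤
      ENNReal.ofReal (Real.sqrt (Rp ^ 2 / (Ri ^ 2 - Rm ^ 2))) * eLpNorm g 2 (volume.restrict F) := by
    rw [eL2, eL2]
    exact sqrt_step (by positivity) (by nlinarith) kg
  have nh : eLpNorm h 2 (volume.restrict F2) ≤
      ENNReal.ofReal (Real.sqrt (1 / δ)) * eLpNorm h 2 (volume.restrict F) := by
    rw [eL2, eL2]
    exact sqrt_step zero_le_one (by linarith) kh
  have r1 : volume.restrict F1 ≤ volume.restrict F := Measure.restrict_mono Set.inter_subset_left le_rfl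
  have r2 : volume.restrict F2 ≤ volume.restrict F := Measure.restrict_mono Set.sdiff_subset le_rfl
  calc ENNReal.ofReal |∫ x in F, g x * h x| = ‖∫ x in F, g x * h x‖ₑ := (Real.enorm_eq_ofReal_abs _).symm
    _ ≤ ∫⁻ x in F, ‖g x * h x‖ₑ := enorm_integral_le_lintegral_enorm _
    _ = (∫⁻ x in F1, ‖g x * h x‖ₑ) + ∫⁻ x in F2, ‖g x * h x‖ₑ :=
        (lintegral_inter_add_sdiff (μ := volume) _ F measurableSet_ball).symm
    _ ≤ eLpNorm g 2 (volume.restrict F1) * eLpNorm h 2 (volume.restrict F1)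
        + eLpNorm g 2 (volume.restrict F2) * eLpNorm h 2 (volume.restrict F2) :=
        add_le_add (CS (hgm.mono_measure r1) (hhm.mono_measure r1)) (CS (hgm.mono_measure r2) (hhm.mono_measure r2))
    _ ≤ (ENNReal.ofReal (Real.sqrt (Rp ^ 2 / (Ri ^ 2 - Rm ^ 2))) * eLpNorm g 2 (volume.restrict F))
          * eLpNorm h 2 (volume.restrict F)
        + eLpNorm g 2 (volume.restrict F) * (ENNReal.ofReal (Real.sqrt (1 / δ)) * eLpNorm h 2 (volume.restrict F)) := by
        gcongr
    _ = _ := by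
        rw [ENNReal.ofReal_add (Real.sqrt_nonneg _) (Real.sqrt_nonneg _)]; ring
end
end

section
/- Under the Geometry hypothesis, let g be harmonic on 𝒢 with ∫_𝒢 |∇g|² dx < ∞, and let k be harmonic on 𝒦 = ℝ² ∖ closure(𝒪) with ∫_𝒦 |∇k|² dx < ∞. If the number m = 1 − (R_- /R_+) − √(R_+²/(R_i² − R_+²)) is positive, then ‖∇k‖_{L²(ℱ)} ≤ m⁻¹ · ‖∇(g + k)‖_{L²(ℱ)}, where the L² norms of the gradients are taken over ℱ. (Estimate (3.18) in the proof of Lemma 3.6.) -/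
open MeasureTheory Metric Filter

noncomputable section

/-- circle mean of `‖f‖²` -/
def circM (f : ℂ → ℂ) (ρ : ℝ) : ℝ :=
  (2 * Real.pi)⁻¹ * ∫ t in (-Real.pi)..Real.pi, ‖f (circleMap 0 ρ t)‖ ^ 2

lemma neg_pi_lt_pi : -Real.pi < Real.pi := by linarith [Real.pi_pos]

lemma cont_circ (f : ℂ → ℂ) (ρ : ℝ) (hρ : 0 < ρ)
    (hf : ∀ z : ℂ, ‖z‖ = ρ → DifferentiableAt ℂ f z) :
    Continuous (fun t => f (circleMap 0 ρ t)) := by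
  rw [continuous_iff_continuousAt]
  intro t
  have h1 : ContinuousAt f (circleMap 0 ρ t) := by
    apply (hf _ _).continuousAt
    simp [abs_of_pos hρ]
  exact ContinuousAt.comp (f := circleMap 0 ρ) h1 (continuous_circleMap 0 ρ).continuousAt

lemma coeff_eq (f : ℂ → ℂ) (ρ : ℝ) (hρ : 0 < ρ) (n : ℤ) :
    fourierCoeffOn neg_pi_lt_pi (fun t => f (circleMap 0 ρ t)) n
      = (ρ : ℂ) ^ n * ((2 * Real.pi * Complex.I)⁻¹ *
        ∮ z in C(0, ρ), (z - 0)⁻¹ • (z ^ (-n) * f z)) := by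
  rw [fourierCoeffOn_eq_integral, circleIntegral]
  have hρ' : (ρ : ℂ) ≠ 0 := by exact_mod_cast hρ.ne'
  have hper : Function.Periodic (fun t => (circleMap 0 ρ t) ^ (-n) * f (circleMap 0 ρ t))
      (2 * Real.pi) := by
    intro t
    simp [periodic_circleMap 0 ρ t]
  have h1 := hper.intervalIntegral_add_eq (-Real.pi) 0
  have h2 : ∀ t : ℝ, deriv (circleMap 0 ρ) t • ((circleMap 0 ρ t - 0)⁻¹ •
      ((circleMap 0 ρ t) ^ (-n) * f (circleMap 0 ρ t)))
      = Complex.I * ((circleMap 0 ρ t) ^ (-n) * f (circleMap 0 ρ t)) := by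
    intro t
    have : circleMap 0 ρ t ≠ 0 := circleMap_ne_center hρ.ne'
    simp only [deriv_circleMap, smul_eq_mul, sub_zero]
    field_simp
  simp_rw [h2]
  have h3 : ∀ t : ℝ, (fourier (-n) (t : AddCircle (Real.pi - -Real.pi)) : ℂ) • f (circleMap 0 ρ t)
      = (ρ : ℂ) ^ n * ((circleMap 0 ρ t) ^ (-n) * f (circleMap 0 ρ t)) := by
    intro t
    have e1 : (circleMap 0 ρ t) ^ (-n) = (ρ : ℂ) ^ (-n) * Complex.exp (-n * (t * Complex.I)) := by
      rw [circleMap_zero, mul_zpow, ← Complex.exp_int_mul]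
      simp
    rw [fourier_coe_apply, e1, zpow_neg, smul_eq_mul]
    have : (ρ : ℂ) ^ n ≠ 0 := zpow_ne_zero _ hρ'
    have hpi : (Real.pi : ℂ) ≠ 0 := by exact_mod_cast Real.pi_ne_zero
    have e2 : 2 * (Real.pi : ℂ) * Complex.I * ((-n : ℤ) : ℂ) * (t : ℂ) / ((Real.pi - -Real.pi : ℝ) : ℂ)
        = -n * (t * Complex.I) := by
      push_cast
      field_simp
      ring
    rw [e2]
    field_simp
  simp_rw [h3]
  rw [intervalIntegral.integral_const_mul, intervalIntegral.integral_const_mul]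
  rw [show -Real.pi + 2 * Real.pi = Real.pi by ring, zero_add] at h1
  rw [h1]
  have : (Real.pi : ℂ) ≠ 0 := by exact_mod_cast Real.pi_ne_zero
  rw [Complex.real_smul]
  push_cast
  field_simp
  ring

lemma laurent (f : ℂ → ℂ) (S : Set ℝ) (hS : S.OrdConnected) (hS0 : S ⊆ Set.Ioi 0)
    (hf : ∀ z : ℂ, ‖z‖ ∈ S → DifferentiableAt ℂ f z) :
    ∃ b : ℤ → ℝ, (∀ n, 0 ≤ b n) ∧
      ∀ ρ ∈ S, HasSum (fun n => b n * ρ ^ (2 * n)) (circM f ρ) := by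
  rcases S.eq_empty_or_nonempty with rfl | ⟨ρ₀, hρ₀⟩
  · exact ⟨0, by simp, by simp⟩
  let I : ℤ → ℝ → ℂ := fun n ρ => ((2 * Real.pi * Complex.I)⁻¹ *
        ∮ z in C(0, ρ), (z - 0)⁻¹ • (z ^ (-n) * f z))
  have hI : ∀ n, ∀ r ∈ S, ∀ R ∈ S, r ≤ R → I n R = I n r := by
    intro n r hr R hR hrR
    have hr0 : 0 < r := hS0 hr
    simp only [I]
    congr 1
    have hd : ∀ z ∈ closedBall (0 : ℂ) R \ ball 0 r,
        DifferentiableAt ℂ (fun z => z ^ (-n) * f z) z := by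
      intro z hz
      simp at hz
      have hz0 : z ≠ 0 := by
        rintro rfl
        simp at hz; linarith
      refine DifferentiableAt.mul (differentiableAt_zpow.2 (Or.inl hz0)) (hf z ?_)
      exact hS.out hr hR ⟨hz.2, hz.1⟩
    apply Complex.circleIntegral_sub_center_inv_smul_eq_of_differentiable_on_annulus_off_countable
      hr0 hrR (Set.countable_empty)
    · intro z hz
      exact (hd z hz).continuousAt.continuousWithinAt
    · intro z hz
      apply hd z
      exact ⟨ball_subset_closedBall hz.1.1, fun h => hz.1.2 (ball_subset_closedBall h)⟩
  refine ⟨fun n => ‖I n ρ₀‖ ^ 2, fun n => by positivity, ?_⟩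
  intro ρ hρ
  have hρ0 : 0 < ρ := hS0 hρ
  have hc := cont_circ f ρ hρ0 (fun z hz => hf z (hz ▸ hρ))
  have hL2 : MemLp (fun t => f (circleMap 0 ρ t)) 2
      (volume.restrict (Set.Ioc (-Real.pi) Real.pi)) := by
    rw [memLp_two_iff_integrable_sq_norm hc.aestronglyMeasurable]
    exact ((hc.norm.pow 2).continuousOn.integrableOn_Icc).mono_set Set.Ioc_subset_Icc_self
  have h := hasSum_sq_fourierCoeffOn neg_pi_lt_pi hL2
  have e : circM f ρ = (Real.pi - -Real.pi)⁻¹ • ∫ x in (-Real.pi)..Real.pi, ‖f (circleMap 0 ρ x)‖ ^ 2 := by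
    rw [circM, smul_eq_mul]; congr 2; ring
  rw [e]
  convert h using 2 with n
  rw [coeff_eq f ρ hρ0 n, norm_mul, mul_pow]
  have : I n ρ = I n ρ₀ := by
    rcases le_total ρ ρ₀ with h | h
    · exact (hI n ρ hρ ρ₀ hρ₀ h).symm
    · exact (hI n ρ₀ hρ₀ ρ hρ h)
  show ‖I n ρ₀‖ ^ 2 * ρ ^ (2 * n) = _
  rw [← this]
  rw [mul_comm]
  congr 1
  rw [norm_zpow, Complex.norm_real, Real.norm_of_nonneg hρ0.le, ← zpow_natCast, ← zpow_mul, mul_comm]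
  rfl

lemma circM_nonneg (f : ℂ → ℂ) (ρ : ℝ) : 0 ≤ circM f ρ := by
  apply mul_nonneg (by have := Real.pi_pos; positivity)
  exact intervalIntegral.integral_nonneg neg_pi_lt_pi.le (fun t _ => by positivity)

lemma polar_symm_eq (ρ t : ℝ) : Complex.polarCoord.symm (ρ, t) = circleMap 0 ρ t := by
  rw [Complex.polarCoord_symm_apply, circleMap_zero, Complex.exp_mul_I]
  simp

lemma lint_circ (f : ℂ → ℂ) (ρ : ℝ) (hρ : 0 < ρ)
    (hf : ∀ z : ℂ, ‖z‖ = ρ → DifferentiableAt ℂ f z) :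
    ∫⁻ t in Set.Ioo (-Real.pi) Real.pi, ENNReal.ofReal (‖f (circleMap 0 ρ t)‖ ^ 2)
      = ENNReal.ofReal (2 * Real.pi * circM f ρ) := by
  have hc : Continuous (fun t => ‖f (circleMap 0 ρ t)‖ ^ 2) := (cont_circ f ρ hρ hf).norm.pow 2
  rw [← ofReal_integral_eq_lintegral_ofReal
    (hc.continuousOn.integrableOn_Icc.mono_set Set.Ioo_subset_Icc_self)
    (Eventually.of_forall fun t => by positivity)]
  congr 1
  rw [circM, ← mul_assoc, mul_inv_cancel₀ (by have := Real.pi_pos; positivity), one_mul,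
    intervalIntegral.integral_of_le neg_pi_lt_pi.le, integral_Ioc_eq_integral_Ioo]

lemma polar_s12 (f : ℂ → ℂ) (hm : Measurable f) (S : Set ℝ) (hSm : MeasurableSet S)
    (hS0 : S ⊆ Set.Ioi 0) (hf : ∀ z : ℂ, ‖z‖ ∈ S → DifferentiableAt ℂ f z) :
    ∫⁻ z in {z : ℂ | ‖z‖ ∈ S}, ENNReal.ofReal (‖f z‖ ^ 2)
      = ∫⁻ ρ in S, ENNReal.ofReal (ρ * (2 * Real.pi * circM f ρ)) := by
  have hA : MeasurableSet {z : ℂ | ‖z‖ ∈ S} := measurable_norm hSm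
  rw [← lintegral_indicator hA, ← Complex.lintegral_comp_polarCoord_symm]
  have hmeas : Measurable (Set.indicator {z : ℂ | ‖z‖ ∈ S}
      (fun z => ENNReal.ofReal (‖f z‖ ^ 2))) :=
    (hm.norm.pow_const 2).ennreal_ofReal.indicator hA
  have hps : Measurable (fun p : ℝ × ℝ => Complex.polarCoord.symm p) := by
    have : (fun p : ℝ × ℝ => Complex.polarCoord.symm p) = fun p => circleMap 0 p.1 p.2 := by
      ext p
      rw [← polar_symm_eq]
    rw [this]
    simp only [circleMap_zero]
    fun_prop
  have htar : polarCoord.target = Set.Ioi (0 : ℝ) ×ˢ Set.Ioo (-Real.pi) Real.pi := rfl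
  rw [htar, Measure.volume_eq_prod, setLIntegral_prod _ (by
    apply Measurable.aemeasurable
    exact (measurable_fst.ennreal_ofReal).smul (hmeas.comp hps))]
  have key : ∀ ρ ∈ Set.Ioi (0 : ℝ),
      ∫⁻ t in Set.Ioo (-Real.pi) Real.pi, ENNReal.ofReal ρ •
        Set.indicator {z : ℂ | ‖z‖ ∈ S} (fun z => ENNReal.ofReal (‖f z‖ ^ 2))
          (Complex.polarCoord.symm (ρ, t))
      = Set.indicator S (fun ρ => ENNReal.ofReal (ρ * (2 * Real.pi * circM f ρ))) ρ := by
    intro ρ hρ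
    have hρ : 0 < ρ := hρ
    by_cases h : ρ ∈ S
    · rw [Set.indicator_of_mem h, ENNReal.ofReal_mul hρ.le,
        ← lint_circ f ρ hρ (fun z hz => hf z (hz ▸ h))]
      rw [← lintegral_const_mul' _ _ ENNReal.ofReal_ne_top]
      congr 1
      ext t
      rw [polar_symm_eq, Set.indicator_of_mem (by simp [abs_of_pos hρ, h]), smul_eq_mul]
    · rw [Set.indicator_of_notMem h]
      rw [← lintegral_zero]
      congr 1
      ext t
      rw [polar_symm_eq, Set.indicator_of_notMem (by simp [abs_of_pos hρ, h]), smul_zero]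
  rw [setLIntegral_congr_fun measurableSet_Ioi key, setLIntegral_indicator hSm,
    Set.inter_eq_left.2 hS0]

lemma lint_lin (a b c : ℝ) (ha : 0 ≤ a) (hab : a ≤ b) (hc : 0 ≤ c) :
    ∫⁻ ρ in Set.Ioo a b, ENNReal.ofReal (ρ * c) = ENNReal.ofReal (c * (b ^ 2 - a ^ 2) / 2) := by
  have hcont : Continuous (fun ρ : ℝ => ρ * c) := by fun_prop
  rw [← ofReal_integral_eq_lintegral_ofReal
    (hcont.continuousOn.integrableOn_Icc.mono_set Set.Ioo_subset_Icc_self)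
    ((ae_restrict_iff' measurableSet_Ioo).2 (Eventually.of_forall fun t ht => 
      mul_nonneg (ha.trans ht.1.le) hc))]
  rw [← integral_Ioc_eq_integral_Ioo, ← intervalIntegral.integral_of_le hab,
    intervalIntegral.integral_mul_const, integral_id]
  congr 1; ring

lemma combine_bound {E1 E2 : ENNReal} {p q X : ℝ} (hp : 0 ≤ p) (hq : 0 ≤ q)
    (h1 : E1 ≤ ENNReal.ofReal (p * X)) (h2 : ENNReal.ofReal (q * X) ≤ E2) :
    E1 * ENNReal.ofReal q ≤ ENNReal.ofReal p * E2 := by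
  calc E1 * ENNReal.ofReal q ≤ ENNReal.ofReal (p * X) * ENNReal.ofReal q := by gcongr
    _ = ENNReal.ofReal p * ENNReal.ofReal (q * X) := by
      rw [ENNReal.ofReal_mul hp, ENNReal.ofReal_mul hq]; ring
    _ ≤ _ := by gcongr

lemma disk_mono (f : ℂ → ℂ) (R : ℝ)
    (hf : ∀ z : ℂ, ‖z‖ < R → DifferentiableAt ℂ f z) {s t : ℝ} (hs : 0 < s) (hst : s ≤ t)
    (ht : t < R) : circM f s ≤ circM f t := by
  obtain ⟨b, hb, hsum⟩ := laurent f (Set.Ioo 0 R) Set.ordConnected_Ioo (fun x hx => hx.1)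
    (fun z hz => hf z hz.2)
  have ht0 : 0 < t := hs.trans_le hst
  obtain ⟨C, hC⟩ : ∃ C, ∀ z ∈ closedBall (0 : ℂ) t, ‖f z‖ ≤ C := by
    apply (isCompact_closedBall (0 : ℂ) t).exists_bound_of_continuousOn
    intro z hz
    exact (hf z (by simp at hz; linarith)).continuousAt.continuousWithinAt
  have hM : ∀ ρ, 0 < ρ → ρ ≤ t → circM f ρ ≤ C ^ 2 := by
    intro ρ h0 h1
    rw [circM]
    have hc : Continuous (fun t => ‖f (circleMap 0 ρ t)‖ ^ 2) :=
      (cont_circ f ρ h0 (fun z hz => hf z (by linarith))).norm.pow 2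
    have : ∫ t in (-Real.pi)..Real.pi, ‖f (circleMap 0 ρ t)‖ ^ 2
        ≤ ∫ t in (-Real.pi)..Real.pi, C ^ 2 := by
      apply intervalIntegral.integral_mono_on neg_pi_lt_pi.le (hc.intervalIntegrable _ _)
        (by simp)
      intro x _
      have := hC (circleMap 0 ρ x) (by simp [abs_of_pos h0, h1])
      gcongr
    rw [intervalIntegral.integral_const, smul_eq_mul] at this
    have hp := Real.pi_pos
    rw [inv_mul_le_iff₀ (by positivity)]
    linarith
  have hb0 : ∀ n : ℤ, n < 0 → b n = 0 := by
    intro n hn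
    apply le_antisymm _ (hb n)
    have hle : ∀ᶠ ρ in nhdsWithin (0 : ℝ) (Set.Ioi 0), b n ≤ C ^ 2 * ρ := by
      filter_upwards [Ioo_mem_nhdsGT (show (0 : ℝ) < min 1 t by positivity)] with ρ hρ
      have hρ0 : 0 < ρ := hρ.1
      have hρt : ρ < t := hρ.2.trans_le (min_le_right _ _)
      have hρ1 : ρ < 1 := hρ.2.trans_le (min_le_left _ _)
      have h1 : b n * ρ ^ (2 * n) ≤ circM f ρ :=
        le_hasSum (hsum ρ ⟨hρ0, hρt.trans ht⟩) n (fun j _ => mul_nonneg (hb j) (by positivity))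
      have h2 := h1.trans (hM ρ hρ0 hρt.le)
      have h3 : b n = (b n * ρ ^ (2 * n)) * ρ ^ (-(2 * n)) := by
        rw [mul_assoc, ← zpow_add₀ hρ0.ne']; simp
      rw [h3]
      have h4 : ρ ^ (-(2 * n)) ≤ ρ := by
        calc ρ ^ (-(2 * n)) ≤ ρ ^ (1 : ℤ) := by
              apply zpow_le_zpow_right_of_le_one₀ hρ0 hρ1.le; omega
          _ = ρ := zpow_one ρ
      exact mul_le_mul h2 h4 (by positivity) (by positivity)
    have hlim : Tendsto (fun ρ : ℝ => C ^ 2 * ρ) (nhdsWithin (0 : ℝ) (Set.Ioi 0)) (nhds 0) := by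
      have : Continuous (fun ρ : ℝ => C ^ 2 * ρ) := by fun_prop
      simpa using (this.tendsto 0).mono_left nhdsWithin_le_nhds
    exact ge_of_tendsto hlim hle
  apply hasSum_le _ (hsum s ⟨hs, hst.trans_lt ht⟩) (hsum t ⟨ht0, ht⟩)
  intro n
  rcases lt_or_ge n 0 with h | h
  · simp [hb0 n h]
  · apply mul_le_mul_of_nonneg_left _ (hb n)
    lift n to ℕ using h
    have : ∀ x : ℝ, x ^ (2 * (n : ℤ)) = x ^ (2 * n) := fun x => by
      rw [← zpow_natCast]; norm_cast
    rw [this, this]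
    gcongr

lemma disk_bound (f : ℂ → ℂ) (hm : Measurable f) (r R : ℝ) (hr : 0 < r) (hrR : r < R)
    (hf : ∀ z : ℂ, ‖z‖ < R → DifferentiableAt ℂ f z) :
    (∫⁻ z in {z : ℂ | ‖z‖ ∈ Set.Ioo 0 r}, ENNReal.ofReal (‖f z‖ ^ 2)) * ENNReal.ofReal (R ^ 2 - r ^ 2)
      ≤ ENNReal.ofReal (r ^ 2) *
        ∫⁻ z in {z : ℂ | ‖z‖ ∈ Set.Ioo r R}, ENNReal.ofReal (‖f z‖ ^ 2) := by
  have hp := Real.pi_pos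
  have hM := circM_nonneg f r
  rw [polar_s12 f hm _ measurableSet_Ioo (fun x hx => hx.1) (fun z hz => hf z (hz.2.trans hrR)),
    polar_s12 f hm _ measurableSet_Ioo (fun x hx => hr.trans hx.1) (fun z hz => hf z hz.2)]
  apply combine_bound (X := Real.pi * circM f r) (by positivity) (by nlinarith)
  · calc _ ≤ ∫⁻ ρ in Set.Ioo 0 r, ENNReal.ofReal (ρ * (2 * Real.pi * circM f r)) := by
          apply setLIntegral_mono' measurableSet_Ioo
          intro ρ hρ
          have := disk_mono f R hf hρ.1 hρ.2.le hrR
          have := hρ.1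
          apply ENNReal.ofReal_le_ofReal
          gcongr
      _ = _ := by
          rw [lint_lin _ _ _ le_rfl hr.le (by positivity)]
          congr 1; ring
      _ ≤ _ := le_rfl
  · calc _ = ∫⁻ ρ in Set.Ioo r R, ENNReal.ofReal (ρ * (2 * Real.pi * circM f r)) := by
          rw [lint_lin _ _ _ hr.le hrR.le (by positivity)]
          congr 1; ring
      _ ≤ _ := by
          apply setLIntegral_mono' measurableSet_Ioo
          intro ρ hρ
          have := disk_mono f R hf hr hρ.1.le hρ.2
          have := hr.trans hρ.1
          apply ENNReal.ofReal_le_ofReal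
          gcongr

lemma lint_cube_Ioo (a b c : ℝ) (ha : 0 < a) (hab : a ≤ b) (hc : 0 ≤ c) :
    ∫⁻ ρ in Set.Ioo a b, ENNReal.ofReal (c * ρ ^ (-3 : ℤ))
      = ENNReal.ofReal (c * (a⁻¹ ^ 2 - b⁻¹ ^ 2) / 2) := by
  have hcont : ContinuousOn (fun ρ : ℝ => c * ρ ^ (-3 : ℤ)) (Set.Icc a b) := by
    apply ContinuousOn.mul continuousOn_const
    intro x hx
    exact (continuousAt_zpow₀ x _ (Or.inl (ha.trans_le hx.1).ne')).continuousWithinAt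
  rw [← ofReal_integral_eq_lintegral_ofReal
    (hcont.integrableOn_Icc.mono_set Set.Ioo_subset_Icc_self)
    ((ae_restrict_iff' measurableSet_Ioo).2 (Eventually.of_forall fun t ht => by
      have := ha.trans ht.1
      show 0 ≤ _
      positivity))]
  rw [← integral_Ioc_eq_integral_Ioo, ← intervalIntegral.integral_of_le hab,
    intervalIntegral.integral_const_mul, integral_zpow (Or.inr ⟨by norm_num, by
      rw [Set.uIcc_of_le hab]; rintro ⟨h, _⟩; linarith⟩)]
  congr 1
  norm_num
  ring

lemma lint_cube_Ioi (a c : ℝ) (ha : 0 < a) (hc : 0 ≤ c) :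
    ∫⁻ ρ in Set.Ioi a, ENNReal.ofReal (c * ρ ^ (-3 : ℤ))
      = ENNReal.ofReal (c * (a⁻¹ ^ 2) / 2) := by
  have h0 : Set.EqOn (fun ρ : ℝ => ENNReal.ofReal (c * ρ ^ (-3 : ℤ)))
    (fun ρ : ℝ => ENNReal.ofReal (c * ρ ^ (-3 : ℝ))) (Set.Ioi a) := by
    intro x hx
    simp only
    congr 2
    rw [← Real.rpow_intCast]; norm_num
  rw [setLIntegral_congr_fun measurableSet_Ioi h0]
  rw [← ofReal_integral_eq_lintegral_ofReal
    ((integrableOn_Ioi_rpow_of_lt (by norm_num) ha).const_mul c)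
    ((ae_restrict_iff' measurableSet_Ioi).2 (Eventually.of_forall fun t ht => by
      have := ha.trans ht
      show 0 ≤ _
      positivity))]
  rw [integral_const_mul, integral_Ioi_rpow_of_lt (by norm_num) ha]
  congr 1
  rw [show (-3 : ℝ) + 1 = ((-2 : ℤ) : ℝ) by norm_num, Real.rpow_intCast]
  norm_num
  ring

lemma ext_mono (f : ℂ → ℂ) (hm : Measurable f) (r₀ : ℝ) (hr₀ : 0 < r₀)
    (hf : ∀ z : ℂ, r₀ < ‖z‖ → DifferentiableAt ℂ f z)
    (hfin : ∫⁻ z in {z : ℂ | ‖z‖ ∈ Set.Ioi r₀}, ENNReal.ofReal (‖f z‖ ^ 2) < ⊤)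
    {s t : ℝ} (hs : r₀ < s) (hst : s ≤ t) :
    circM f t * t ^ 4 ≤ circM f s * s ^ 4 := by
  obtain ⟨b, hb, hsum⟩ := laurent f (Set.Ioi r₀) Set.ordConnected_Ioi (fun x hx => hr₀.trans hx)
    (fun z hz => hf z hz)
  have hs0 : 0 < s := hr₀.trans hs
  have ht0 : 0 < t := hs0.trans_le hst
  rw [polar_s12 f hm _ measurableSet_Ioi (fun x hx => hr₀.trans hx) (fun z hz => hf z hz)] at hfin
  have hb0 : ∀ n : ℤ, -1 ≤ n → b n = 0 := by
    intro n hn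
    by_contra hne
    have hbn : 0 < b n := lt_of_le_of_ne (hb n) (Ne.symm hne)
    have hp := Real.pi_pos
    have hsub : Set.Ioi (max r₀ 1) ⊆ Set.Ioi r₀ := Set.Ioi_subset_Ioi (le_max_left _ _)
    have h1 : ∫⁻ ρ in Set.Ioi (max r₀ 1), ENNReal.ofReal ((2 * Real.pi * b n) * ρ⁻¹) < ⊤ := by
      refine lt_of_le_of_lt ?_ hfin
      refine le_trans ?_ (lintegral_mono_set hsub)
      apply setLIntegral_mono' measurableSet_Ioi
      intro ρ hρ
      have hρr : r₀ < ρ := hsub hρ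
      have hρ1 : 1 < ρ := (le_max_right _ _).trans_lt hρ
      have hρ0 : 0 < ρ := by linarith
      apply ENNReal.ofReal_le_ofReal
      have h2 : b n * ρ ^ (2 * n) ≤ circM f ρ :=
        le_hasSum (hsum ρ hρr) n (fun j _ => mul_nonneg (hb j) (by
          exact (zpow_nonneg hρ0.le _)))
      have h3 : ρ⁻¹ ≤ ρ * ρ ^ (2 * n) := by
        rw [← zpow_one_add₀ hρ0.ne', ← zpow_neg_one]
        apply zpow_le_zpow_right₀ hρ1.le; omega
      calc 2 * Real.pi * b n * ρ⁻¹ ≤ 2 * Real.pi * b n * (ρ * ρ ^ (2 * n)) := by gcongr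
        _ = ρ * (2 * Real.pi * (b n * ρ ^ (2 * n))) := by ring
        _ ≤ _ := by gcongr
    have h2 : IntegrableOn (fun ρ : ℝ => (2 * Real.pi * b n) * ρ⁻¹) (Set.Ioi (max r₀ 1)) := by
      refine ⟨by apply Measurable.aestronglyMeasurable; fun_prop, ?_⟩
      rw [hasFiniteIntegral_iff_ofReal]
      · exact h1
      · refine (ae_restrict_iff' measurableSet_Ioi).2 (Eventually.of_forall fun ρ hρ => ?_)
        have hρ1 : r₀ < ρ := (le_max_left _ _).trans_lt hρ
        have : 0 < ρ := by linarith
        show 0 ≤ _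
        positivity
    have h3 : IntegrableOn (fun ρ : ℝ => ρ⁻¹) (Set.Ioi (max r₀ 1)) := by
      have := h2.const_mul (2 * Real.pi * b n)⁻¹
      refine this.congr (Eventually.of_forall fun ρ => ?_)
      simp only
      field_simp
    exact not_integrableOn_Ioi_inv h3
  have hmul : ∀ x : ℝ, 0 < x → ∀ n : ℤ, b n * x ^ (2 * n) * x ^ 4 = b n * x ^ (2 * n + 4) := by
    intro x hx n
    rw [zpow_add₀ hx.ne', mul_assoc]; norm_cast
  apply hasSum_le _ ((hsum t (hs.trans_le hst)).mul_right (t ^ 4)) ((hsum s hs).mul_right (s ^ 4))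
  intro n
  rw [hmul _ ht0, hmul _ hs0]
  rcases le_or_gt (-1) n with h | h
  · simp [hb0 n h]
  · apply mul_le_mul_of_nonneg_left _ (hb n)
    obtain ⟨j, hj⟩ : ∃ j : ℕ, 2 * n + 4 = -(j : ℤ) := ⟨(-(2 * n + 4)).toNat, by omega⟩
    rw [hj, zpow_neg, zpow_neg, zpow_natCast, zpow_natCast]
    gcongr

lemma ext_bound (f : ℂ → ℂ) (hm : Measurable f) (r₀ r : ℝ) (hr₀ : 0 < r₀) (hr : r₀ < r)
    (hf : ∀ z : ℂ, r₀ < ‖z‖ → DifferentiableAt ℂ f z)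
    (hfin : ∫⁻ z in {z : ℂ | ‖z‖ ∈ Set.Ioi r₀}, ENNReal.ofReal (‖f z‖ ^ 2) < ⊤) :
    (∫⁻ z in {z : ℂ | ‖z‖ ∈ Set.Ici r}, ENNReal.ofReal (‖f z‖ ^ 2)) * ENNReal.ofReal (r ^ 2 - r₀ ^ 2)
      ≤ ENNReal.ofReal (r₀ ^ 2) *
        ∫⁻ z in {z : ℂ | ‖z‖ ∈ Set.Ioo r₀ r}, ENNReal.ofReal (‖f z‖ ^ 2) := by
  have hp := Real.pi_pos
  have hM := circM_nonneg f r
  have hr0 : 0 < r := hr₀.trans hr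
  rw [polar_s12 f hm _ measurableSet_Ici (fun x hx => hr0.trans_le hx)
      (fun z hz => hf z (hr.trans_le hz)),
    polar_s12 f hm _ measurableSet_Ioo (fun x hx => hr₀.trans hx.1) (fun z hz => hf z hz.1)]
  have hid : ∀ ρ : ℝ, 0 < ρ → ρ * (2 * Real.pi * circM f ρ)
      = 2 * Real.pi * (circM f ρ * ρ ^ 4) * ρ ^ (-3 : ℤ) := by
    intro ρ hρ
    rw [zpow_neg]; norm_cast
    field_simp
  apply combine_bound (X := Real.pi * circM f r * (r ^ 2 / r₀ ^ 2)) (by positivity) (by nlinarith)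
  · rw [setLIntegral_congr (Ioi_ae_eq_Ici (a := r)).symm]
    calc _ ≤ ∫⁻ ρ in Set.Ioi r, ENNReal.ofReal
            (2 * Real.pi * (circM f r * r ^ 4) * ρ ^ (-3 : ℤ)) := by
          apply setLIntegral_mono' measurableSet_Ioi
          intro ρ hρ
          have hρ' : r < ρ := hρ
          have := ext_mono f hm r₀ hr₀ hf hfin hr hρ'.le
          have h0 : 0 < ρ := hr0.trans hρ'
          rw [hid ρ h0]
          apply ENNReal.ofReal_le_ofReal
          gcongr
      _ = _ := by
          rw [lint_cube_Ioi _ _ hr0 (by positivity)]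
          congr 1; field_simp
      _ ≤ _ := le_rfl
  · calc _ = ∫⁻ ρ in Set.Ioo r₀ r, ENNReal.ofReal
            (2 * Real.pi * (circM f r * r ^ 4) * ρ ^ (-3 : ℤ)) := by
          rw [lint_cube_Ioo _ _ _ hr₀ hr.le (by positivity)]
          congr 1; field_simp
      _ ≤ _ := by
          apply setLIntegral_mono' measurableSet_Ioo
          intro ρ hρ
          have := ext_mono f hm r₀ hr₀ hf hfin hρ.1 hρ.2.le
          have h0 : 0 < ρ := hr₀.trans hρ.1
          rw [hid ρ h0]
          apply ENNReal.ofReal_le_ofReal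
          gcongr

lemma le_of_sq_le_sq_aux {a b : ℝ} (h : a ^ 2 ≤ b ^ 2) (hb : 0 ≤ b) : a ≤ b :=
  (abs_le.1 (abs_le_of_sq_le_sq h hb)).2

/-- The isometry `ℂ ≃ ℝ²`. -/
def LL : ℂ ≃ₗᵢ[ℝ] Pt := Complex.orthonormalBasisOneI.repr

lemma LL_one : LL 1 = EuclideanSpace.single 0 (1 : ℝ) := by
  ext i
  fin_cases i <;> simp [LL, Complex.orthonormalBasisOneI_repr_apply]

lemma LL_I : LL Complex.I = EuclideanSpace.single 1 (1 : ℝ) := by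
  ext i
  fin_cases i <;> simp [LL, Complex.orthonormalBasisOneI_repr_apply]

/-- complex gradient -/
def FF (k : Pt → ℝ) (c : Pt) (z : ℂ) : ℂ :=
  (fderiv ℝ k (c + LL z) (LL 1) : ℂ) - Complex.I * (fderiv ℝ k (c + LL z) (LL Complex.I) : ℂ)

lemma FF_meas (k : Pt → ℝ) (c : Pt) : Measurable (FF k c) := by
  have hT : Measurable (fun z : ℂ => c + LL z) := by
    apply Continuous.measurable
    exact continuous_const.add LL.continuous
  have h1 : ∀ v, Measurable (fun z : ℂ => ((fderiv ℝ k (c + LL z) v : ℝ) : ℂ)) := fun v =>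
    Complex.measurable_ofReal.comp ((measurable_fderiv_apply_const ℝ k v).comp hT)
  exact (h1 _).sub ((h1 _).const_mul _)

lemma grad_coord (k : Pt → ℝ) (x : Pt) (i : Fin 2) :
    gradient k x i = fderiv ℝ k x (EuclideanSpace.single i (1 : ℝ)) := by
  rw [← toDual_gradient, InnerProductSpace.toDual_apply_apply, EuclideanSpace.inner_single_right]
  simp

lemma FF_norm (k : Pt → ℝ) (c : Pt) (z : ℂ) : ‖FF k c z‖ ^ 2 = ‖gradient k (c + LL z)‖ ^ 2 := by
  rw [EuclideanSpace.norm_sq_eq, Fin.sum_univ_two, grad_coord, grad_coord, FF, LL_one, LL_I,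
    ← Complex.normSq_eq_norm_sq, Complex.normSq_apply]
  simp
  ring

lemma grad_meas (k : Pt → ℝ) : Measurable (gradient k) := by
  have : gradient k = fun x => (InnerProductSpace.toDual ℝ Pt).symm (fderiv ℝ k x) := rfl
  rw [this]
  exact (InnerProductSpace.toDual ℝ Pt).symm.continuous.measurable.comp (measurable_fderiv ℝ k)

lemma FF_diff (k : Pt → ℝ) (c : Pt) (U : Set Pt) (hU : IsOpen U) (hk : IsHarmonicOn k U)
    (z : ℂ) (hz : c + LL z ∈ U) : DifferentiableAt ℂ (FF k c) z := by
  let u : ℂ → ℝ := fun w => k (c + LL w)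
  have hT : Continuous (fun z : ℂ => c + LL z) := continuous_const.add LL.continuous
  have hV : IsOpen ((fun z : ℂ => c + LL z) ⁻¹' U) := hU.preimage hT
  have hfd : ∀ w, HasFDerivAt (fun z : ℂ => c + LL z)
      (LL.toContinuousLinearEquiv : ℂ →L[ℝ] Pt) w := fun w =>
    (LL.toContinuousLinearEquiv.hasFDerivAt (x := w)).const_add c
  have hcd : ∀ x ∈ U, ContDiffAt ℝ 2 k x := fun x hx => hk.1.contDiffAt (hU.mem_nhds hx)
  have hu : ∀ w, c + LL w ∈ U → ∀ v, fderiv ℝ u w v = fderiv ℝ k (c + LL w) (LL v) := by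
    intro w hw v
    have h1 := (((hcd _ hw).differentiableAt two_ne_zero).hasFDerivAt).comp w (hfd w)
    have : fderiv ℝ u w = _ := h1.fderiv
    rw [this]; rfl
  have hlap : ∀ w, c + LL w ∈ U → Laplacian.laplacian u w = 0 := by
    intro w hw
    have e1 : u = (fun y => k (c + y)) ∘ LL.toContinuousLinearEquiv := rfl
    have e2 : ∀ v, iteratedFDeriv ℝ 2 u w (fun _ => v)
        = iteratedFDeriv ℝ 2 k (c + LL w) (fun _ => LL v) := by
      intro v
      have := LL.toContinuousLinearEquiv.iteratedFDerivWithin_comp_right (fun y => k (c + y))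
        uniqueDiffOn_univ (x := w) (Set.mem_univ _) 2
      rw [Set.preimage_univ, iteratedFDerivWithin_univ, iteratedFDerivWithin_univ,
        iteratedFDeriv_comp_add_left] at this
      rw [e1, this]
      rfl
    have h0 := hk.2 _ hw
    rw [lap, Fin.sum_univ_two, ← LL_one, ← LL_I, ← e2, ← e2] at h0
    rw [InnerProductSpace.laplacian_eq_iteratedFDeriv_complexPlane]
    simp only
    convert h0 using 3 <;> · ext i; fin_cases i <;> rfl
  have hharm : InnerProductSpace.HarmonicAt u z := by
    refine ⟨?_, ?_⟩
    · exact (hcd _ hz).comp z (contDiffAt_const.add LL.contDiff.contDiffAt)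
    · filter_upwards [hV.mem_nhds hz] with w hw
      exact hlap w hw
  have h := HarmonicAt.differentiableAt_complex_partial hharm
  refine h.congr_of_eventuallyEq ?_
  filter_upwards [hV.mem_nhds hz] with w hw
  rw [FF, hu w hw, hu w hw]

lemma transfer (k : Pt → ℝ) (c : Pt) (S : Set ℝ) (hS : MeasurableSet S) :
    ∫⁻ x in {x : Pt | dist x c ∈ S}, ENNReal.ofReal (‖gradient k x‖ ^ 2)
      = ∫⁻ z in {z : ℂ | ‖z‖ ∈ S}, ENNReal.ofReal (‖FF k c z‖ ^ 2) := by
  have hmp : MeasurePreserving (fun z : ℂ => c + LL z) :=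
    (measurePreserving_add_left volume c).comp LL.measurePreserving
  have hA : MeasurableSet {x : Pt | dist x c ∈ S} :=
    (measurable_id.dist measurable_const) hS
  rw [← hmp.setLIntegral_comp_preimage hA ((grad_meas k).norm.pow_const 2).ennreal_ofReal]
  have : (fun z : ℂ => c + LL z) ⁻¹' {x : Pt | dist x c ∈ S} = {z : ℂ | ‖z‖ ∈ S} := by
    ext z
    simp [dist_eq_norm]
  rw [this]
  simp_rw [FF_norm]

lemma real_of_lint {h : Pt → ℝ} {A B : Set Pt} {p q : ℝ} (h0 : ∀ x, 0 ≤ h x)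
    (hA : IntegrableOn h A) (hB : IntegrableOn h B) (hp : 0 ≤ p)
    (hh : (∫⁻ x in A, ENNReal.ofReal (h x)) * ENNReal.ofReal q
      ≤ ENNReal.ofReal p * ∫⁻ x in B, ENNReal.ofReal (h x)) :
    (∫ x in A, h x) * q ≤ p * ∫ x in B, h x := by
  rw [← ofReal_integral_eq_lintegral_ofReal hA (Eventually.of_forall h0),
    ← ofReal_integral_eq_lintegral_ofReal hB (Eventually.of_forall h0),
    ← ENNReal.ofReal_mul (integral_nonneg h0), ← ENNReal.ofReal_mul hp] at hh
  exact (ENNReal.ofReal_le_ofReal_iff (mul_nonneg hp (integral_nonneg h0))).1 hh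

lemma minkowski {A : Set Pt} {a b : Pt → Pt} (ha : Measurable a) (hb : Measurable b)
    (ia : IntegrableOn (fun x => ‖a x‖ ^ 2) A) (ib : IntegrableOn (fun x => ‖b x‖ ^ 2) A) :
    IntegrableOn (fun x => ‖a x + b x‖ ^ 2) A ∧
    Real.sqrt (∫ x in A, ‖a x‖ ^ 2)
      ≤ Real.sqrt (∫ x in A, ‖a x + b x‖ ^ 2) + Real.sqrt (∫ x in A, ‖b x‖ ^ 2) := by
  have ma : MemLp a 2 (volume.restrict A) :=
    (memLp_two_iff_integrable_sq_norm ha.aestronglyMeasurable).2 ia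
  have mb : MemLp b 2 (volume.restrict A) :=
    (memLp_two_iff_integrable_sq_norm hb.aestronglyMeasurable).2 ib
  have mab := ma.add mb
  have key : ∀ f : Pt → Pt, MemLp f 2 (volume.restrict A) →
      lpNorm f 2 (volume.restrict A) = Real.sqrt (∫ x in A, ‖f x‖ ^ 2) := by
    intro f hf
    rw [lpNorm_eq_integral_norm_rpow_toReal (by simp) (by simp) hf.1, Real.sqrt_eq_rpow]
    norm_num
  refine ⟨(memLp_two_iff_integrable_sq_norm mab.1).1 mab, ?_⟩
  have h := lpNorm_sub_le mab (g := b) (p := 2) (by norm_num)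
  rw [add_sub_cancel_right, key _ ma, key _ mab, key _ mb] at h
  exact h

lemma final_real (Ri Rp Rm ks kg hs hg gs gg m : ℝ) (h0 : 0 < Rm) (h1 : Rm < Rp) (h2 : Rp < Ri)
    (hks : 0 ≤ ks) (hkg : 0 ≤ kg) (hgg : 0 ≤ gg)
    (hG : gs ^ 2 * (Ri ^ 2 - Rp ^ 2) ≤ Rp ^ 2 * gg ^ 2)
    (hK : kg ^ 2 * (Rp ^ 2 - Rm ^ 2) ≤ Rm ^ 2 * ks ^ 2)
    (e1 : ks ≤ hs + gs) (e2 : gg ≤ hg + kg)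
    (hm : m = 1 - Rm / Rp - Real.sqrt (Rp ^ 2 / (Ri ^ 2 - Rp ^ 2))) (hmpos : 0 < m) :
    Real.sqrt (ks ^ 2 + kg ^ 2) ≤ m⁻¹ * Real.sqrt (hs ^ 2 + hg ^ 2) := by
  have hp : 0 < Rp := h0.trans h1
  have hd : 0 < Ri ^ 2 - Rp ^ 2 := by nlinarith
  set s := Real.sqrt (Rp ^ 2 / (Ri ^ 2 - Rp ^ 2)) with hsdef
  have hs0 : 0 ≤ s := Real.sqrt_nonneg _
  have hs2 : s ^ 2 = Rp ^ 2 / (Ri ^ 2 - Rp ^ 2) := Real.sq_sqrt (by positivity)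
  have hgs' : gs ≤ s * gg := by
    apply le_of_sq_le_sq_aux _ (by positivity)
    rw [mul_pow, hs2, div_mul_eq_mul_div, le_div_iff₀ hd]
    exact hG
  set r := Rm / Rp with hrdef
  have hr0 : 0 ≤ r := by positivity
  set K := Real.sqrt (ks ^ 2 + kg ^ 2) with hKdef
  set H := Real.sqrt (hs ^ 2 + hg ^ 2) with hHdef
  have hK0 : 0 ≤ K := Real.sqrt_nonneg _
  have hK2 : K ^ 2 = ks ^ 2 + kg ^ 2 := Real.sq_sqrt (by positivity)
  have hH0 : 0 ≤ H := Real.sqrt_nonneg _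
  have hH2 : H ^ 2 = hs ^ 2 + hg ^ 2 := Real.sq_sqrt (by positivity)
  have a1 : hs ≤ H := Real.le_sqrt_of_sq_le (by nlinarith)
  have a2 : hg ≤ H := Real.le_sqrt_of_sq_le (by nlinarith)
  have hkr : kg ≤ r * K := by
    apply le_of_sq_le_sq_aux _ (by positivity)
    rw [mul_pow, hK2, hrdef, div_pow, div_mul_eq_mul_div, le_div_iff₀ (by positivity)]
    linarith
  have hKs : K ≤ ks + kg := by
    apply le_of_sq_le_sq_aux _ (by positivity)
    rw [hK2]; nlinarith [mul_nonneg hks hkg]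
  rw [le_inv_mul_iff₀ hmpos]
  have b1 : K ≤ H + s * (H + r * K) + r * K := by
    have : s * gg ≤ s * (H + r * K) := by gcongr; linarith
    linarith
  have b2 : (m * K) * (1 + s) ≤ H * (1 + s) := by
    rw [hm]
    nlinarith [mul_nonneg (mul_nonneg hs0 hs0) hK0]
  exact le_of_mul_le_mul_right b2 (by positivity)

theorem stmt12 (𝒢 𝒪 : Set Pt) (c : Pt) (Re Ri Rp Rm δ δ₀ : ℝ)
    (geom : Geometry 𝒢 𝒪 c Re Ri Rp Rm δ δ₀)
    (g : Pt → ℝ) (hg : IsHarmonicOn g 𝒢)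
    (hgdir : IntegrableOn (fun x => ‖gradient g x‖ ^ 2) 𝒢)
    (k : Pt → ℝ) (hk : IsHarmonicOn k (closure 𝒪)ᶜ)
    (hkdir : IntegrableOn (fun x => ‖gradient k x‖ ^ 2) (closure 𝒪)ᶜ)
    (m : ℝ) (hm : m = 1 - Rm / Rp - Real.sqrt (Rp ^ 2 / (Ri ^ 2 - Rp ^ 2)))
    (hmpos : 0 < m) :
    Real.sqrt (∫ x in 𝒢 \ closure 𝒪, ‖gradient k x‖ ^ 2)
      ≤ m⁻¹ * Real.sqrt (∫ x in 𝒢 \ closure 𝒪, ‖gradient (fun y => g y + k y) x‖ ^ 2) := by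
  obtain ⟨oG, oO, -, -, -, -, hOG, hm0, hmp, hpi, -, -, hDi, -, -, hOm, -, -, -, -⟩ := geom
  have hp0 : 0 < Rp := hm0.trans hmp
  have oK : IsOpen (closure 𝒪)ᶜ := isClosed_closure.isOpen_compl
  have hOd : ∀ x ∈ closure 𝒪, dist x c < Rm := fun x hx => hOm hx
  set Sg : Set Pt := ball c Rp \ closure 𝒪 with hSg
  set Gm : Set Pt := 𝒢 \ ball c Rp with hGm
  have hballG : ball c Ri ⊆ 𝒢 := ball_subset_closedBall.trans hDi
  have hF : 𝒢 \ closure 𝒪 = Sg ∪ Gm := by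
    ext x
    simp only [hSg, hGm, Set.mem_diff, Set.mem_union, mem_ball]
    constructor
    · rintro ⟨h1, h2⟩
      by_cases h : dist x c < Rp
      · exact Or.inl ⟨h, h2⟩
      · exact Or.inr ⟨h1, h⟩
    · rintro (⟨h1, h2⟩ | ⟨h1, h2⟩)
      · exact ⟨hballG (show dist x c < Ri by linarith), h2⟩
      · exact ⟨h1, fun h => h2 (by linarith [hOd x h])⟩
  have hdisj : Disjoint Sg Gm :=
    Set.disjoint_left.2 (fun x h1 h2 => h2.2 h1.1)
  have mGm : MeasurableSet Gm := oG.measurableSet.diff measurableSet_ball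
  have hSgG : Sg ⊆ 𝒢 := fun x hx => (hF ▸ (Or.inl hx : x ∈ Sg ∪ Gm) : x ∈ 𝒢 \ closure 𝒪).1
  have hSgK : Sg ⊆ (closure 𝒪)ᶜ := fun x hx => hx.2
  have hGmG : Gm ⊆ 𝒢 := fun x hx => hx.1
  have hGmK : Gm ⊆ (closure 𝒪)ᶜ := fun x hx h => hx.2 (show dist x c < Rp by linarith [hOd x h])
  -- gradient of the sum
  have hsum : ∀ x ∈ 𝒢 \ closure 𝒪,
      gradient (fun y => g y + k y) x = gradient g x + gradient k x := by
    intro x hx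
    have d1 : DifferentiableAt ℝ g x :=
      (hg.1.contDiffAt (oG.mem_nhds hx.1)).differentiableAt two_ne_zero
    have d2 : DifferentiableAt ℝ k x :=
      (hk.1.contDiffAt (oK.mem_nhds hx.2)).differentiableAt two_ne_zero
    show (InnerProductSpace.toDual ℝ Pt).symm _ = _
    rw [fderiv_fun_add d1 d2, map_add]
    rfl
  have mF : MeasurableSet (𝒢 \ closure 𝒪) := oG.measurableSet.diff isClosed_closure.measurableSet
  have hint : ∫ x in 𝒢 \ closure 𝒪, ‖gradient (fun y => g y + k y) x‖ ^ 2
      = ∫ x in 𝒢 \ closure 𝒪, ‖gradient g x + gradient k x‖ ^ 2 :=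
    setIntegral_congr_fun mF (fun x hx => by simp only [hsum x hx])
  rw [hint, hF]
  have nn : ∀ a : Pt → Pt, ∀ x, 0 ≤ ‖a x‖ ^ 2 := fun a x => by positivity
  have nni : ∀ (a : Pt → Pt) (A : Set Pt), 0 ≤ ∫ x in A, ‖a x‖ ^ 2 :=
    fun a A => integral_nonneg (nn a)
  have iks := hkdir.mono_set hSgK
  have ikg := hkdir.mono_set hGmK
  have igs := hgdir.mono_set hSgG
  have igg := hgdir.mono_set hGmG
  obtain ⟨ihs, e1⟩ := minkowski (grad_meas k) (grad_meas g) iks igs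
  obtain ⟨ihg, e2⟩ := minkowski (grad_meas g) (grad_meas k) igg ikg
  simp_rw [add_comm (gradient k _)] at ihs e1
  rw [setIntegral_union hdisj mGm iks ikg, setIntegral_union hdisj mGm ihs ihg]
  -- disk estimate
  have hG : (∫ x in ball c Rp, ‖gradient g x‖ ^ 2) * (Ri ^ 2 - Rp ^ 2)
      ≤ Rp ^ 2 * ∫ x in {x : Pt | dist x c ∈ Set.Ioo Rp Ri}, ‖gradient g x‖ ^ 2 := by
    refine real_of_lint (nn _) (hgdir.mono_set ((ball_subset_ball hpi.le).trans hballG))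
      (hgdir.mono_set (fun x hx => hballG hx.2)) (by positivity) ?_
    have hae : ball c Rp =ᵐ[volume] {x : Pt | dist x c ∈ Set.Ioo 0 Rp} := by
      have : {x : Pt | dist x c ∈ Set.Ioo 0 Rp} = ball c Rp \ {c} := by
        ext x
        simp [and_comm]
      rw [this]
      exact (diff_null_ae_eq_self (measure_singleton c)).symm
    rw [setLIntegral_congr hae, transfer g c _ measurableSet_Ioo, transfer g c _ measurableSet_Ioo]
    exact disk_bound (FF g c) (FF_meas g c) Rp Ri hp0 hpi (fun z hz =>
      FF_diff g c 𝒢 oG hg z (hballG (by simpa [dist_eq_norm] using hz)))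
  have hsubK : ∀ x : Pt, Rm < dist x c → x ∈ (closure 𝒪)ᶜ := fun x hx h => by
    linarith [hOd x h]
  have hK : (∫ x in {x : Pt | dist x c ∈ Set.Ici Rp}, ‖gradient k x‖ ^ 2) * (Rp ^ 2 - Rm ^ 2)
      ≤ Rm ^ 2 * ∫ x in {x : Pt | dist x c ∈ Set.Ioo Rm Rp}, ‖gradient k x‖ ^ 2 := by
    refine real_of_lint (nn _) (hkdir.mono_set (fun x hx => hsubK x (hmp.trans_le hx)))
      (hkdir.mono_set (fun x hx => hsubK x hx.1)) (by positivity) ?_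
    rw [transfer k c _ measurableSet_Ici, transfer k c _ measurableSet_Ioo]
    refine ext_bound (FF k c) (FF_meas k c) Rm Rp hm0 hmp (fun z hz =>
      FF_diff k c _ oK hk z (hsubK _ (by simpa [dist_eq_norm] using hz))) ?_
    rw [← transfer k c _ measurableSet_Ioi]
    have hi : IntegrableOn (fun x => ‖gradient k x‖ ^ 2) {x : Pt | dist x c ∈ Set.Ioi Rm} :=
      hkdir.mono_set (fun x hx => hsubK x hx)
    exact (hasFiniteIntegral_iff_ofReal (Eventually.of_forall (nn _))).1 hi.2
  have mono : ∀ (a : Pt → Pt) (A B : Set Pt), A ⊆ B → IntegrableOn (fun x => ‖a x‖ ^ 2) B →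
      ∫ x in A, ‖a x‖ ^ 2 ≤ ∫ x in B, ‖a x‖ ^ 2 := fun a A B hAB hB =>
    setIntegral_mono_set hB (Eventually.of_forall (nn a)) hAB.eventuallyLE
  have m1 := mono (gradient g) Sg (ball c Rp) (fun x hx => hx.1)
    (hgdir.mono_set ((ball_subset_ball hpi.le).trans hballG))
  have m2 := mono (gradient g) {x : Pt | dist x c ∈ Set.Ioo Rp Ri} Gm
    (fun x hx => ⟨hballG hx.2, fun h => lt_asymm hx.1 h⟩) igg
  have m3 := mono (gradient k) Gm {x : Pt | dist x c ∈ Set.Ici Rp} (fun x hx => by have h := hx.2; rw [mem_ball, not_lt] at h; exact h)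
    (hkdir.mono_set (fun x hx => hsubK x (hmp.trans_le hx)))
  have m4 := mono (gradient k) {x : Pt | dist x c ∈ Set.Ioo Rm Rp} Sg
    (fun x hx => ⟨hx.2, hsubK x hx.1⟩) iks
  have d1 : 0 ≤ Ri ^ 2 - Rp ^ 2 := by nlinarith
  have d2 : 0 ≤ Rp ^ 2 - Rm ^ 2 := by nlinarith
  have res := final_real Ri Rp Rm _ _ _ _ _ _ m hm0 hmp hpi
    (Real.sqrt_nonneg (∫ x in Sg, ‖gradient k x‖ ^ 2))
    (Real.sqrt_nonneg (∫ x in Gm, ‖gradient k x‖ ^ 2))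
    (Real.sqrt_nonneg (∫ x in Gm, ‖gradient g x‖ ^ 2))
    (by
      rw [Real.sq_sqrt (nni _ _), Real.sq_sqrt (nni _ _)]
      exact (mul_le_mul_of_nonneg_right m1 d1).trans
        (hG.trans (mul_le_mul_of_nonneg_left m2 (by positivity))))
    (by
      rw [Real.sq_sqrt (nni _ _), Real.sq_sqrt (nni _ _)]
      exact (mul_le_mul_of_nonneg_right m3 d2).trans
        (hK.trans (mul_le_mul_of_nonneg_left m4 (by positivity))))
    e1 e2 hm hmpos
  rw [Real.sq_sqrt (nni _ _), Real.sq_sqrt (nni _ _), Real.sq_sqrt (nni (fun x => _ + _) _),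
    Real.sq_sqrt (nni (fun x => _ + _) _)] at res
  exact res
end
end

section
/- Under the Geometry hypothesis, let h be harmonic on 𝒪 and square-integrable on 𝒪, and let g be harmonic on 𝒢 and square-integrable on 𝒢. Define ω on 𝒢 by ω = h on 𝒪 and ω = g on ℱ. If ∫_𝒢 ω(x) g'(x) dx = 0 for every function g' that is harmonic on 𝒢 and square-integrable on 𝒢, then ‖g‖_{L²(ℱ)} ≤ √(R_-²/(R_i² − R_-²)) · ‖h‖_{L²(𝒪)}. (Estimate (3.15) of Lemma 3.7.) -/
open MeasureTheory Metric Filter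

noncomputable section

section Aux
open InnerProductSpace

lemma jensen_aux (u : ℂ → ℝ) (hu : HarmonicOnNhd u (closedBall 0 1)) (t : ℝ) (ht0 : 0 < t)
    (ht1 : t < 1) :
    u t ^ 2 ≤ Real.circleAverage (fun z => poissonKernel 0 t z * u z ^ 2) 0 1 := by
  have htm : (t : ℂ) ∈ ball (0 : ℂ) 1 := by simp [abs_of_pos ht0, ht1]
  have hP : ContinuousOn (poissonKernel 0 (t:ℂ)) (sphere 0 |(1:ℝ)|) := by
    rw [poissonKernel_eq_re_herglotzRieszKernel]
    exact Complex.continuous_re.comp_continuousOn (continuousOn_herglotzRieszKernel_sphere htm)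
  have hP0 : ∀ z ∈ sphere (0:ℂ) |(1:ℝ)|, 0 ≤ poissonKernel 0 (t:ℂ) z := by
    intro z hz
    have : ‖z‖ = 1 := by simpa using hz
    rw [poissonKernel_def]
    apply div_nonneg _ (by positivity)
    simp [this, abs_of_pos ht0]; nlinarith
  have huc : ContinuousOn u (sphere 0 |(1:ℝ)|) :=
    hu.contDiffOn.continuousOn.mono (by simpa using sphere_subset_closedBall)
  have h1 : Real.circleAverage (fun z => poissonKernel 0 t z * u z) 0 1 = u t :=
    hu.circleAverage_poissonKernel_smul htm
  have h2 : Real.circleAverage (fun z => poissonKernel 0 t z * 1) 0 1 = 1 :=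
    HarmonicOnNhd.circleAverage_poissonKernel_smul (f := fun _ => (1:ℝ))
      (fun x _ => harmonicAt_const _) htm
  have h3 : 0 ≤ Real.circleAverage (fun z => poissonKernel 0 t z * (u z - u t) ^ 2) 0 1 := by
    apply Real.circleAverage_nonneg_of_nonneg
    intro z hz
    exact mul_nonneg (hP0 z hz) (sq_nonneg _)
  have i1 : CircleIntegrable (fun z => poissonKernel 0 (t:ℂ) z * u z ^ 2) 0 1 :=
    ContinuousOn.circleIntegrable' (hP.mul (huc.pow 2))
  have i2 : CircleIntegrable (fun z => (2 * u t) • (poissonKernel 0 (t:ℂ) z * u z)) 0 1 :=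
    ContinuousOn.circleIntegrable' ((hP.fun_mul huc).const_smul (2 * u t))
  have i3 : CircleIntegrable (fun z => (u t ^ 2) • (poissonKernel 0 (t:ℂ) z * 1)) 0 1 :=
    ContinuousOn.circleIntegrable' ((hP.fun_mul continuousOn_const).const_smul (u t ^ 2))
  have i12 : CircleIntegrable (fun z => poissonKernel 0 (t:ℂ) z * u z ^ 2 -
      (2 * u t) • (poissonKernel 0 (t:ℂ) z * u z)) 0 1 := i1.sub i2
  have e : (fun z => poissonKernel 0 (t:ℂ) z * (u z - u t) ^ 2) =
      fun z => (poissonKernel 0 (t:ℂ) z * u z ^ 2 - (2 * u t) • (poissonKernel 0 (t:ℂ) z * u z)) +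
        (u t ^ 2) • (poissonKernel 0 (t:ℂ) z * 1) := by
    ext z; simp only [smul_eq_mul]; ring
  rw [e, Real.circleAverage_fun_add i12 i3, Real.circleAverage_fun_sub i1 i2,
    Real.circleAverage_fun_smul, Real.circleAverage_fun_smul, h1, h2] at h3
  simp only [smul_eq_mul] at h3
  linarith

lemma dilate_aux (f : ℂ → ℝ) (R : ℝ) (hf : HarmonicOnNhd f (closedBall 0 R)) (t : ℝ)
    (ht0 : 0 < t) (ht1 : t < 1) :
    ∫ x in ball (0:ℂ) R, f (t • x) ^ 2 ≤ ∫ x in ball (0:ℂ) R, f x ^ 2 := by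
  obtain ⟨F, hF, hFf⟩ := (hf.mono ball_subset_closedBall).exists_analyticOnNhd_ball_re_eq
  have htm : (t : ℂ) ∈ ball (0 : ℂ) 1 := by simp [abs_of_pos ht0, ht1]
  have hfc : ContinuousOn f (closedBall 0 R) := hf.contDiffOn.continuousOn
  set p : ℝ → ℝ := fun θ => poissonKernel 0 t (circleMap 0 1 θ) with hp
  have hpc : Continuous p := by
    have hP : ContinuousOn (poissonKernel 0 (t:ℂ)) (sphere 0 |(1:ℝ)|) := by
      rw [poissonKernel_eq_re_herglotzRieszKernel]
      exact Complex.continuous_re.comp_continuousOn (continuousOn_herglotzRieszKernel_sphere htm)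
    exact hP.comp_continuous (continuous_circleMap 0 1) (fun θ => by simp)
  have hp1 : (2 * Real.pi)⁻¹ * ∫ θ in 0..2 * Real.pi, p θ = 1 := by
    have h2 := HarmonicOnNhd.circleAverage_poissonKernel_smul (f := fun _ => (1:ℝ))
      (R := 1) (fun x _ => harmonicAt_const _) htm
    simpa [Real.circleAverage_def] using h2
  -- pointwise inequality
  have key : ∀ x ∈ ball (0:ℂ) R, f (t • x) ^ 2 ≤
      (2 * Real.pi)⁻¹ * ∫ θ in 0..2 * Real.pi, p θ * f (circleMap 0 1 θ * x) ^ 2 := by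
    intro x hx
    have hx' : ‖x‖ < R := by simpa using hx
    have hmem : ∀ w ∈ closedBall (0:ℂ) 1, w * x ∈ ball (0:ℂ) R := by
      intro w hw
      have hw' : ‖w‖ ≤ 1 := by simpa using hw
      simp only [mem_ball_zero_iff, norm_mul]
      nlinarith [norm_nonneg x]
    have hu : HarmonicOnNhd (fun w : ℂ => (F (w * x)).re) (closedBall 0 1) := by
      intro w hw
      apply AnalyticAt.harmonicAt_re
      exact (hF _ (hmem w hw)).fun_comp (f := fun w : ℂ => w * x) (by fun_prop)
    have := jensen_aux _ hu t ht0 ht1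
    have e1 : (F (t * x)).re = f (t * x) := hFf (hmem _ (ball_subset_closedBall htm))
    have e2 : ∀ θ : ℝ, (F (circleMap 0 1 θ * x)).re = f (circleMap 0 1 θ * x) := fun θ =>
      hFf (hmem _ (by simp))
    simpa only [e1, Real.circleAverage_def, e2, smul_eq_mul, Complex.real_smul] using this
  -- integrability on the product
  have hint : Integrable (Function.uncurry fun (θ : ℝ) (x : ℂ) => p θ * f (circleMap 0 1 θ * x) ^ 2)
      ((volume.restrict (Set.uIoc 0 (2 * Real.pi))).prod (volume.restrict (ball (0:ℂ) R))) := by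
    rw [Measure.prod_restrict]
    have hc : ContinuousOn (Function.uncurry
        fun (θ : ℝ) (x : ℂ) => p θ * f (circleMap 0 1 θ * x) ^ 2)
        (Set.uIcc 0 (2 * Real.pi) ×ˢ closedBall (0:ℂ) R) := by
      apply ContinuousOn.mul (hpc.comp continuous_fst).continuousOn
      apply ContinuousOn.pow
      apply hfc.comp (f := fun q : ℝ × ℂ => circleMap 0 1 q.1 * q.2)
      · exact (((continuous_circleMap 0 1).comp continuous_fst).mul continuous_snd).continuousOn
      · rintro ⟨θ, x⟩ ⟨_, hx⟩
        simpa using hx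
    have : IntegrableOn _ _ ((volume : Measure ℝ).prod (volume : Measure ℂ)) :=
      hc.integrableOn_compact (isCompact_uIcc.prod (isCompact_closedBall _ _))
    exact this.mono_set (Set.prod_mono Set.uIoc_subset_uIcc ball_subset_closedBall)
  -- rotation invariance
  have hrot : ∀ θ : ℝ, ∫ x in ball (0:ℂ) R, f (circleMap 0 1 θ * x) ^ 2 =
      ∫ x in ball (0:ℂ) R, f x ^ 2 := by
    intro θ
    have := (rotation (Circle.exp θ)).measurePreserving.setIntegral_preimage_emb
      (rotation (Circle.exp θ)).toMeasurableEquiv.measurableEmbedding (fun x => f x ^ 2)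
      (ball (0:ℂ) R)
    rw [← this]
    have hpre : (rotation (Circle.exp θ)) ⁻¹' (ball (0:ℂ) R) = ball 0 R := by
      ext x; simp only [Set.mem_preimage, mem_ball_zero_iff, LinearIsometryEquiv.norm_map]
    rw [hpre]
    simp [circleMap, rotation_apply]
  have hL : IntegrableOn (fun x : ℂ => f (t • x) ^ 2) (ball (0:ℂ) R) := by
    have hc : ContinuousOn (fun x : ℂ => f (t • x) ^ 2) (closedBall 0 R) := by
      apply ContinuousOn.pow
      apply hfc.comp (by fun_prop)
      intro x hx
      have : ‖x‖ ≤ R := by simpa using hx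
      simp [abs_of_pos ht0]; nlinarith [norm_nonneg x]
    exact (hc.integrableOn_compact (isCompact_closedBall _ _)).mono_set ball_subset_closedBall
  calc ∫ x in ball (0:ℂ) R, f (t • x) ^ 2
      ≤ ∫ x in ball (0:ℂ) R,
        (2 * Real.pi)⁻¹ * ∫ θ in 0..2 * Real.pi, p θ * f (circleMap 0 1 θ * x) ^ 2 := by
        apply setIntegral_mono_on hL _ measurableSet_ball key
        apply Integrable.const_mul
        have := hint.integral_prod_right
        simpa [intervalIntegral.integral_of_le Real.two_pi_pos.le,
          Set.uIoc_of_le Real.two_pi_pos.le] using this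
    _ = (2 * Real.pi)⁻¹ * ∫ θ in 0..2 * Real.pi, ∫ x in ball (0:ℂ) R,
          p θ * f (circleMap 0 1 θ * x) ^ 2 := by
        rw [integral_const_mul, intervalIntegral_integral_swap hint]
    _ = ∫ x in ball (0:ℂ) R, f x ^ 2 := by
        simp_rw [integral_const_mul, hrot]
        rw [intervalIntegral.integral_mul_const, ← mul_assoc, hp1, one_mul]

lemma ball_aux (f : ℂ → ℝ) (r R : ℝ) (hr : 0 < r) (hrR : r < R)
    (hf : HarmonicOnNhd f (closedBall 0 R)) :
    R ^ 2 * ∫ x in ball (0:ℂ) r, f x ^ 2 ≤ r ^ 2 * ∫ x in ball (0:ℂ) R, f x ^ 2 := by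
  have hR : 0 < R := hr.trans hrR
  have h := dilate_aux f R hf (r / R) (by positivity) ((div_lt_one hR).2 hrR)
  have ht : 0 < r / R := by positivity
  rw [Measure.setIntegral_comp_smul_of_pos volume (fun x => f x ^ 2) _ ht,
    _root_.smul_ball ht.ne', Complex.finrank_real_complex, smul_zero, Real.norm_of_nonneg ht.le,
    div_mul_cancel₀ _ hR.ne', smul_eq_mul, inv_mul_le_iff₀ (by positivity), div_pow,
    div_mul_eq_mul_div, le_div_iff₀ (by positivity)] at h
  linarith

lemma lap_eq (g : Pt → ℝ) (c : Pt) (z : ℂ) :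
    Laplacian.laplacian (fun z : ℂ => g (c + Complex.orthonormalBasisOneI.repr z)) z =
      lap g (c + Complex.orthonormalBasisOneI.repr z) := by
  set L := Complex.orthonormalBasisOneI.repr with hL
  have h := ContinuousLinearEquiv.iteratedFDerivWithin_comp_right (𝕜 := ℝ)
    L.toContinuousLinearEquiv
    (fun y => g (c + y)) uniqueDiffOn_univ (x := z) (Set.mem_univ _) 2
  simp only [Set.preimage_univ, iteratedFDerivWithin_univ] at h
  rw [iteratedFDeriv_comp_add_left] at h
  rw [laplacian_eq_iteratedFDeriv_orthonormalBasis _ Complex.orthonormalBasisOneI]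
  have h' : iteratedFDeriv ℝ 2 (fun z : ℂ => g (c + L z)) z = _ := h
  simp only [h', lap]
  refine Finset.sum_congr rfl fun i _ => ?_
  rw [ContinuousMultilinearMap.compContinuousLinearMap_apply]
  congr 1
  ext1 j
  have : L (Complex.orthonormalBasisOneI i) = EuclideanSpace.single i (1:ℝ) := by
    rw [hL, OrthonormalBasis.repr_self]
  fin_cases j <;> exact this

lemma ball_pt (g : Pt → ℝ) (G : Set Pt) (hG : IsOpen G) (hg : IsHarmonicOn g G) (c : Pt)
    (r R : ℝ) (hr : 0 < r) (hrR : r < R) (hsub : closedBall c R ⊆ G) :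
    R ^ 2 * ∫ x in ball c r, g x ^ 2 ≤ r ^ 2 * ∫ x in ball c R, g x ^ 2 := by
  set L := Complex.orthonormalBasisOneI.repr with hL
  have hcont : Continuous (fun z : ℂ => c + L z) := by fun_prop
  have hharm : HarmonicOnNhd (fun z : ℂ => g (c + L z)) (closedBall 0 R) := by
    intro z hz
    have hz' : c + L z ∈ G := by
      apply hsub
      simpa [dist_eq_norm] using hz
    refine ⟨?_, ?_⟩
    · have := hg.1.contDiffAt (hG.mem_nhds hz')
      exact this.comp (f := fun z : ℂ => c + L z) z
        (contDiffAt_const.add L.contDiff.contDiffAt)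
    · filter_upwards [hcont.continuousAt.preimage_mem_nhds (hG.mem_nhds hz')] with y hy
      rw [lap_eq]
      exact hg.2 _ hy
  have hmp : MeasurePreserving (fun z : ℂ => c + L z) volume volume :=
    (measurePreserving_add_left volume c).comp L.measurePreserving
  have hemb : MeasurableEmbedding (fun z : ℂ => c + L z) :=
    (MeasurableEquiv.addLeft c).measurableEmbedding.comp L.toMeasurableEquiv.measurableEmbedding
  have hb : ∀ s : ℝ, ∫ x in ball (0:ℂ) s, g (c + L x) ^ 2 = ∫ x in ball c s, g x ^ 2 := by
    intro s
    rw [← hmp.setIntegral_preimage_emb hemb (fun x => g x ^ 2)]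
    congr 2
    ext x
    simp [dist_eq_norm]
  have := ball_aux _ r R hr hrR hharm
  rwa [hb, hb] at this

end Aux

open Classical in
theorem stmt13 (𝒢 𝒪 : Set Pt) (c : Pt) (Re Ri Rp Rm δ δ₀ : ℝ)
    (geom : Geometry 𝒢 𝒪 c Re Ri Rp Rm δ δ₀)
    (h : Pt → ℝ) (hh : IsHarmonicOn h 𝒪) (hhL2 : IntegrableOn (fun x => h x ^ 2) 𝒪)
    (g : Pt → ℝ) (hg : IsHarmonicOn g 𝒢) (hgL2 : IntegrableOn (fun x => g x ^ 2) 𝒢)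
    (horth : ∀ g' : Pt → ℝ, IsHarmonicOn g' 𝒢 → IntegrableOn (fun x => g' x ^ 2) 𝒢 →
      (∫ x in 𝒢, (if x ∈ 𝒪 then h x else g x) * g' x) = 0) :
    Real.sqrt (∫ x in 𝒢 \ closure 𝒪, g x ^ 2)
      ≤ Real.sqrt (Rm ^ 2 / (Ri ^ 2 - Rm ^ 2)) * Real.sqrt (∫ x in 𝒪, h x ^ 2) := by
  obtain ⟨hGo, hOo⟩ := And.intro geom.openG geom.openO
  have hOG : 𝒪 ⊆ 𝒢 := subset_closure.trans geom.clO_sub_G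
  have hRm := geom.Rm_pos
  have hlt : Rm < Ri := geom.Rm_lt_Rp.trans geom.Rp_lt_Ri
  have hball := ball_pt g 𝒢 hGo hg c Rm Ri hRm hlt geom.clDi_sub
  have hgO : IntegrableOn (fun x => g x ^ 2) 𝒪 := hgL2.mono_set hOG
  have hgD : IntegrableOn (fun x => g x ^ 2) (𝒢 \ 𝒪) := hgL2.mono_set Set.diff_subset
  have hmeasD : MeasurableSet (𝒢 \ 𝒪) := hGo.measurableSet.diff hOo.measurableSet
  have hnn : ∀ s : Set Pt, ∀ᵐ x ∂(volume.restrict s), 0 ≤ g x ^ 2 :=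
    fun s => Eventually.of_forall fun x => sq_nonneg _
  have hRiG : ball c Ri ⊆ 𝒢 := ball_subset_closedBall.trans geom.clDi_sub
  have h1 : ∫ x in 𝒪, g x ^ 2 ≤ ∫ x in ball c Rm, g x ^ 2 :=
    setIntegral_mono_set (hgL2.mono_set ((ball_subset_ball hlt.le).trans hRiG)) (hnn _)
      (Eventually.of_forall (subset_closure.trans geom.clO_sub))
  have h2 : ∫ x in ball c Ri, g x ^ 2 ≤ ∫ x in 𝒢, g x ^ 2 :=
    setIntegral_mono_set hgL2 (hnn _) (Eventually.of_forall hRiG)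
  have hU : 𝒪 ∪ (𝒢 \ 𝒪) = 𝒢 := Set.union_diff_cancel hOG
  have hdisj : Disjoint 𝒪 (𝒢 \ 𝒪) := Set.disjoint_sdiff_right
  have h3 : ∫ x in 𝒢, g x ^ 2 = (∫ x in 𝒪, g x ^ 2) + ∫ x in 𝒢 \ 𝒪, g x ^ 2 := by
    rw [← setIntegral_union hdisj hmeasD hgO hgD, hU]
  have h4 : ∫ x in 𝒢 \ closure 𝒪, g x ^ 2 ≤ ∫ x in 𝒢 \ 𝒪, g x ^ 2 :=
    setIntegral_mono_set hgD (hnn _)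
      (Eventually.of_forall (Set.diff_subset_diff_right subset_closure))
  have hgm : AEStronglyMeasurable g (volume.restrict 𝒪) :=
    (hg.1.continuousOn.mono hOG).aestronglyMeasurable hOo.measurableSet
  have hhm : AEStronglyMeasurable h (volume.restrict 𝒪) :=
    hh.1.continuousOn.aestronglyMeasurable hOo.measurableSet
  have hprod : IntegrableOn (fun x => h x * g x) 𝒪 := by
    refine Integrable.mono' (hhL2.add hgO) (hhm.mul hgm) (Eventually.of_forall fun x => ?_)
    simp only [Pi.add_apply, Real.norm_eq_abs]
    rw [abs_le]
    constructor <;> nlinarith [sq_nonneg (h x + g x), sq_nonneg (h x - g x)]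
  have e1 : Set.EqOn (fun x => (if x ∈ 𝒪 then h x else g x) * g x) (fun x => h x * g x) 𝒪 := by
    intro x hx; simp [hx]
  have e2 : Set.EqOn (fun x => (if x ∈ 𝒪 then h x else g x) * g x) (fun x => g x ^ 2)
      (𝒢 \ 𝒪) := by
    intro x hx; simp [hx.2, sq]
  have h5 : (∫ x in 𝒪, h x * g x) + ∫ x in 𝒢 \ 𝒪, g x ^ 2 = 0 := by
    rw [← horth g hg hgL2, ← setIntegral_congr_fun hOo.measurableSet e1,
      ← setIntegral_congr_fun hmeasD e2, ← setIntegral_union hdisj hmeasD, hU]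
    · exact hprod.congr_fun e1.symm hOo.measurableSet
    · exact hgD.congr_fun e2.symm hmeasD
  set a := ∫ x in 𝒪, g x ^ 2
  set b := ∫ x in 𝒢 \ 𝒪, g x ^ 2
  set H := ∫ x in 𝒪, h x ^ 2
  have hDen : 0 < Ri ^ 2 - Rm ^ 2 := by nlinarith
  set k := Rm ^ 2 / (Ri ^ 2 - Rm ^ 2) with hk
  have hkpos : 0 < k := by positivity
  have hab : a ≤ k * b := by
    rw [hk, div_mul_eq_mul_div, le_div_iff₀ hDen]
    have i1 := mul_le_mul_of_nonneg_left h1 (sq_nonneg Ri)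
    have i2 := mul_le_mul_of_nonneg_left h2 (sq_nonneg Rm)
    rw [h3] at i2
    linarith
  have h6 : -(∫ x in 𝒪, h x * g x) ≤ k / 2 * H + (2 * k)⁻¹ * a := by
    rw [← integral_neg, ← integral_const_mul, ← integral_const_mul,
      ← integral_add (hhL2.const_mul _) (hgO.const_mul _)]
    apply integral_mono hprod.neg ((hhL2.const_mul _).add (hgO.const_mul _))
    intro x
    have : k / 2 * h x ^ 2 + (2 * k)⁻¹ * g x ^ 2 + h x * g x
        = (2 * k)⁻¹ * (k * h x + g x) ^ 2 := by
      field_simp; ring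
    have h0 : 0 ≤ (2 * k)⁻¹ * (k * h x + g x) ^ 2 := by positivity
    simp only [Pi.neg_apply, Pi.add_apply]
    linarith
  have h7 : (2 * k)⁻¹ * a ≤ b / 2 := by
    rw [inv_mul_le_iff₀ (by positivity)]; linarith
  have h8 : b ≤ k * H := by linarith
  rw [← Real.sqrt_mul hkpos.le]
  exact Real.sqrt_le_sqrt (h4.trans h8)
end
end
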